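/- arXiv:1510.05260 — 3 statements merged into one kernel-verified Lean document; each statement's English description precedes it below -/
import Mathlib

section
/- Assume the abc conjecture: for every ε > 0 there exists a constant K(ε) such that for all positive integers a, b, c with a + b = c and gcd(a, b) = 1 one has c ≤ K(ε) · rad(abc)^{1+ε}, where rad(m) is the product of the distinct primes dividing m. Then the set W of powerful numbers contains no infinite Hilbert cube: there do not exist a non-negative integer a₀ and an infinite sequence a₁, a₂, a₃, … of positive integers such that a₀ + Σ_{i∈F} a_i is powerful for every finite nonempty set F of indices. -/
/-- A positive integer is powerful if every prime dividing it does so at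
least to the second power. -/
def Powerful (n : ℕ) : Prop := 0 < n ∧ ∀ p : ℕ, p.Prime → p ∣ n → p ^ 2 ∣ n

/-- The radical of `m`: the product of the distinct primes dividing `m`. -/
def rad (m : ℕ) : ℕ := ∏ p ∈ m.primeFactors, p

lemma rad_pos (m : ℕ) : 0 < rad m :=
  Finset.prod_pos fun _ hp => (Nat.prime_of_mem_primeFactors hp).pos

lemma rad_le_self {m : ℕ} (hm : 0 < m) : rad m ≤ m :=
  Nat.le_of_dvd hm (Nat.prod_primeFactors_dvd m)

lemma rad_le_of_dvd {m n : ℕ} (h : m ∣ n) (hn : n ≠ 0) : rad m ≤ rad n :=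
  Finset.prod_le_prod_of_subset_of_one_le' (Nat.primeFactors_mono h hn)
    fun _ hp _ => (Nat.prime_of_mem_primeFactors hp).one_lt.le

lemma rad_mul_le (m n : ℕ) : rad (m * n) ≤ rad m * rad n := by
  have h0 : rad 0 = 1 := by simp [rad]
  rcases eq_or_ne m 0 with rfl | hm
  · simpa [h0] using Nat.succ_le_of_lt (rad_pos n)
  rcases eq_or_ne n 0 with rfl | hn
  · simpa [h0] using Nat.succ_le_of_lt (rad_pos m)
  unfold rad
  rw [Nat.primeFactors_mul hm hn, ← Finset.prod_union_inter]
  exact Nat.le_mul_of_pos_right _ <| Finset.prod_pos fun p hp =>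
    (Nat.prime_of_mem_primeFactors (Finset.mem_inter.mp hp).1).pos

lemma rad_pow_le (m k : ℕ) : rad (m ^ k) ≤ rad m := by
  rcases eq_or_ne k 0 with rfl | hk
  · have h1 : rad 1 = 1 := by simp [rad]
    simpa [h1] using Nat.succ_le_of_lt (rad_pos m)
  · rw [rad, Nat.primeFactors_pow m hk, rad]

lemma Powerful.rad_sq_le {n : ℕ} (hn : Powerful n) : rad n ^ 2 ≤ n := by
  refine Nat.le_of_dvd hn.1 ?_
  rw [rad, ← Finset.prod_pow]
  refine Finset.prod_dvd_of_isRelPrime ?_ fun p hp =>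
    hn.2 p (Nat.prime_of_mem_primeFactors hp) (Nat.dvd_of_mem_primeFactors hp)
  intro p hp q hq hpq
  exact Nat.coprime_iff_isRelPrime.mp <| Nat.Coprime.pow 2 2 <|
    (Nat.coprime_primes (Nat.prime_of_mem_primeFactors hp)
      (Nat.prime_of_mem_primeFactors hq)).mpr hpq

/-- The polynomial `(y - d) ^ (2 * d) * (y + e) ^ (2 * e)` is constant modulo `y ^ 2`. -/
lemma sq_dvd_pow_mul_pow_sub {d e : ℕ} (hd : 0 < d) (he : 0 < e) (y : ℤ) :
    y ^ 2 ∣ (y - d) ^ (2 * d) * (y + e) ^ (2 * e) - (d : ℤ) ^ (2 * d) * (e : ℤ) ^ (2 * e) := by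
  obtain ⟨r, hr⟩ := Polynomial.powAddExpansion (d : ℤ) (-y) (2 * d)
  obtain ⟨s, hs⟩ := Polynomial.powAddExpansion (e : ℤ) y (2 * e)
  have hd' : (d : ℤ) ^ (2 * d - 1) * d = (d : ℤ) ^ (2 * d) := by
    rw [← pow_succ]; congr 1; omega
  have he' : (e : ℤ) ^ (2 * e - 1) * e = (e : ℤ) ^ (2 * e) := by
    rw [← pow_succ]; congr 1; omega
  have h₁ : (y - d) ^ (2 * d) = (d : ℤ) ^ (2 * d) * (1 - 2 * y) + r * y ^ 2 := by
    rw [show (y - d : ℤ) = -(d + -y) by ring, (even_two_mul d).neg_pow, hr]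
    push_cast
    linear_combination (-2 * y) * hd'
  have h₂ : (y + e) ^ (2 * e) = (e : ℤ) ^ (2 * e) * (1 + 2 * y) + s * y ^ 2 := by
    rw [add_comm y, hs]
    push_cast
    linear_combination (2 * y) * he'
  rw [h₁, h₂]
  generalize (d : ℤ) ^ (2 * d) = D
  generalize (e : ℤ) ^ (2 * e) = E
  exact ⟨-4 * D * E + D * (1 - 2 * y) * s + r * E * (1 + 2 * y) + r * s * y ^ 2, by ring⟩

/-- A version of abc without the coprimality hypothesis, at the cost of a factor `a`. -/
lemma exists_le_mul_rad_rpow_of_abc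
    (abc : ∀ ε : ℝ, 0 < ε → ∃ K : ℝ, ∀ a b c : ℕ, 0 < a → 0 < b → 0 < c →
      a + b = c → Nat.gcd a b = 1 → (c : ℝ) ≤ K * (rad (a * b * c) : ℝ) ^ (1 + ε))
    {ε : ℝ} (hε : 0 < ε) :
    ∃ K : ℝ, ∀ a b c : ℕ, 0 < a → 0 < b → 0 < c → a + b = c →
      (c : ℝ) ≤ a * (K * (rad (a * b * c) : ℝ) ^ (1 + ε)) := by
  obtain ⟨K, hK⟩ := abc ε hε
  refine ⟨|K|, fun a b c ha hb hc hsum => ?_⟩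
  obtain ⟨g, a', b', hg, hcop, rfl, rfl⟩ := Nat.exists_coprime' (Nat.gcd_pos_of_pos_left b ha)
  have ha' : 0 < a' := Nat.pos_of_mul_pos_right ha
  have hb' : 0 < b' := Nat.pos_of_mul_pos_right hb
  obtain rfl : (a' + b') * g = c := by rw [← hsum]; ring
  have h := hK a' b' (a' + b') ha' hb' (by omega) rfl hcop
  have hr : rad (a' * b' * (a' + b')) ≤ rad (a' * g * (b' * g) * ((a' + b') * g)) :=
    rad_le_of_dvd ⟨g ^ 3, by ring⟩ (by positivity)
  calc (((a' + b') * g : ℕ) : ℝ) = g * ((a' + b' : ℕ) : ℝ) := by push_cast; ring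
    _ ≤ ((a' * g : ℕ) : ℝ) * ((a' + b' : ℕ) : ℝ) := by
      gcongr
      exact Nat.le_mul_of_pos_left g ha'
    _ ≤ _ := by
      gcongr
      refine h.trans ?_
      gcongr
      exact le_abs_self K

/-- If `n`, `n + d` and `n + d + e` are powerful, then the additive triple formed by
`d ^ (2 * d) * e ^ (2 * e)` and `n ^ (2 * d) * (n + d + e) ^ (2 * e)` has a small radical. -/
lemma exists_add_eq_rad_sq_mul_le {d e n : ℕ} (hd : 0 < d) (he : 0 < e) (hdn : d ≤ n)
    (h₀ : Powerful n) (h₁ : Powerful (n + d)) (h₂ : Powerful (n + d + e)) :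
    ∃ M : ℕ, 0 < M ∧
      d ^ (2 * d) * e ^ (2 * e) + M = n ^ (2 * d) * (n + d + e) ^ (2 * e) ∧
      rad (d ^ (2 * d) * e ^ (2 * e) * M * (n ^ (2 * d) * (n + d + e) ^ (2 * e))) ^ 2 * (n + d) ≤
        (1 + e) * (d ^ (2 * d) * e ^ (2 * e)) ^ 2 *
          (n ^ (2 * d) * (n + d + e) ^ (2 * e)) ^ 2 := by
  have hlt : d ^ (2 * d) * e ^ (2 * e) < n ^ (2 * d) * (n + d + e) ^ (2 * e) :=
    Nat.mul_lt_mul_of_le_of_lt (Nat.pow_le_pow_left hdn _)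
      (Nat.pow_lt_pow_left (by omega) (by omega)) (pow_pos (hd.trans_le hdn) _)
  have hdvd := sq_dvd_pow_mul_pow_sub hd he ((n + d : ℕ) : ℤ)
  have hc : 0 < d ^ (2 * d) * e ^ (2 * e) := by positivity
  have hradN : rad (n ^ (2 * d) * (n + d + e) ^ (2 * e)) ≤ rad n * rad (n + d + e) :=
    (rad_mul_le _ _).trans (Nat.mul_le_mul (rad_pow_le _ _) (rad_pow_le _ _))
  rw [show (((n + d : ℕ) : ℤ) - d) = n by push_cast; ring,
    show (((n + d : ℕ) : ℤ) + e) = ((n + d + e : ℕ) : ℤ) by push_cast; ring] at hdvd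
  replace hdvd : (((n + d : ℕ) : ℤ)) ^ 2 ∣ ((n ^ (2 * d) * (n + d + e) ^ (2 * e) : ℕ) : ℤ) -
      ((d ^ (2 * d) * e ^ (2 * e) : ℕ) : ℤ) := by exact_mod_cast hdvd
  generalize d ^ (2 * d) * e ^ (2 * e) = c at *
  generalize n ^ (2 * d) * (n + d + e) ^ (2 * e) = N at *
  rw [← Nat.cast_sub hlt.le] at hdvd
  obtain ⟨Q, hQ⟩ : (n + d) ^ 2 ∣ N - c := by exact_mod_cast hdvd
  have hM : 0 < (n + d) ^ 2 * Q := by omega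
  have hQ0 : 0 < Q := Nat.pos_of_mul_pos_left hM
  refine ⟨(n + d) ^ 2 * Q, hM, by omega, ?_⟩
  have hrad : rad (c * ((n + d) ^ 2 * Q) * N) ≤
      c * (rad (n + d) * Q) * (rad n * rad (n + d + e)) :=
    calc _ ≤ rad (c * ((n + d) ^ 2 * Q)) * rad N := rad_mul_le _ _
      _ ≤ (rad c * (rad ((n + d) ^ 2) * rad Q)) * rad N :=
        Nat.mul_le_mul_right _ <| (rad_mul_le _ _).trans <|
          Nat.mul_le_mul_left _ (rad_mul_le _ _)
      _ ≤ _ := by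
        gcongr
        · exact rad_le_self hc
        · exact rad_pow_le _ _
        · exact rad_le_self hQ0
  calc _ ≤ (c * (rad (n + d) * Q) * (rad n * rad (n + d + e))) ^ 2 * (n + d) := by gcongr
    _ = c ^ 2 * Q ^ 2 * (n + d) * (rad (n + d) ^ 2 * (rad n ^ 2 * rad (n + d + e) ^ 2)) := by
      ring
    _ ≤ c ^ 2 * Q ^ 2 * (n + d) * ((n + d) * ((n + d) * ((1 + e) * (n + d)))) := by
      gcongr
      · exact h₁.rad_sq_le
      · exact h₀.rad_sq_le.trans (by omega)
      · exact h₂.rad_sq_le.trans (by nlinarith)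
    _ = (1 + e) * c ^ 2 * ((n + d) ^ 2 * Q) ^ 2 := by ring
    _ ≤ _ := by gcongr; omega

lemma exists_bound_of_abc
    (abc : ∀ ε : ℝ, 0 < ε → ∃ K : ℝ, ∀ a b c : ℕ, 0 < a → 0 < b → 0 < c →
      a + b = c → Nat.gcd a b = 1 → (c : ℝ) ≤ K * (rad (a * b * c) : ℝ) ^ (1 + ε))
    {d e : ℕ} (hd : 0 < d) (he : 0 < e) :
    ∃ G : ℝ, ∀ n : ℕ, d ≤ n → Powerful n → Powerful (n + d) → Powerful (n + d + e) →
      (n : ℝ) ≤ G := by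
  set ε : ℝ := 1 / (8 * (d + e)) with hε
  have hε0 : 0 < ε := by positivity
  obtain ⟨K, hK⟩ := exists_le_mul_rad_rpow_of_abc abc hε0
  set c := d ^ (2 * d) * e ^ (2 * e) with hc
  have hc0 : 0 < c := by positivity
  set B : ℝ := 1 + e with hB
  have hB0 : 0 < B := by positivity
  set E : ℝ := (B * c ^ 2) ^ ε with hE
  have hE0 : 0 ≤ E := by positivity
  set G : ℝ := c ^ 2 * K ^ 2 * E * B * c ^ 2
  have hG0 : 0 ≤ G := by positivity
  refine ⟨G ^ 2 * B, fun n hdn h₀ h₁ h₂ => ?_⟩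
  obtain ⟨M, hM, hsum, hrad⟩ := exists_add_eq_rad_sq_mul_le hd he hdn h₀ h₁ h₂
  rw [← hc] at hsum hrad
  have hn0 := h₀.1
  set N := n ^ (2 * d) * (n + d + e) ^ (2 * e) with hN
  have hN0 : 0 < N := by positivity
  have key := hK c M N hc0 hM hN0 hsum
  set X : ℝ := (rad (c * M * N) : ℝ) with hX
  have hX0 : 0 < X := by rw [hX]; exact_mod_cast rad_pos _
  set y : ℝ := n + d with hy
  have hy1 : 1 ≤ y := by
    have : (1 : ℝ) ≤ n := by exact_mod_cast hn0
    rw [hy]; linarith [(Nat.cast_nonneg d : (0 : ℝ) ≤ d)]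
  have hrad' : X ^ 2 * y ≤ B * c ^ 2 * (N : ℝ) ^ 2 := by
    rw [hX, hy, hB]
    exact_mod_cast hrad
  have hNy : (N : ℝ) ≤ (B * y) ^ (2 * (d + e)) := by
    have h1 : (n : ℝ) ≤ B * y := by
      have : (0 : ℝ) ≤ e := Nat.cast_nonneg e
      have : (0 : ℝ) ≤ d := Nat.cast_nonneg d
      nlinarith
    have h2 : (n : ℝ) + d + e ≤ B * y := by
      have : (0 : ℝ) ≤ e := Nat.cast_nonneg e
      nlinarith
    rw [mul_add 2 d e, pow_add, hN]
    push_cast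
    gcongr
  have hXε : (X ^ ε) ^ 2 ≤ E * √(B * y) :=
    calc (X ^ ε) ^ 2 = (X ^ 2) ^ ε := by
          rw [← Real.rpow_natCast, ← Real.rpow_natCast, ← Real.rpow_mul hX0.le,
            ← Real.rpow_mul hX0.le, mul_comm]
      _ ≤ (B * c ^ 2 * ((B * y) ^ (2 * (d + e))) ^ 2) ^ ε := by
          gcongr
          calc X ^ 2 ≤ X ^ 2 * y := le_mul_of_one_le_right (by positivity) hy1
            _ ≤ B * c ^ 2 * (N : ℝ) ^ 2 := hrad'
            _ ≤ _ := by gcongr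
      _ = E * √(B * y) := by
          rw [Real.mul_rpow (by positivity) (by positivity), ← hE, ← pow_mul,
            ← Real.rpow_natCast, ← Real.rpow_mul (by positivity), Real.sqrt_eq_rpow]
          congr 2
          rw [hε]
          push_cast
          field_simp
          norm_num
  have hNsq : (N : ℝ) ^ 2 * y ≤ (N : ℝ) ^ 2 * (G * √(B * y)) :=
    calc (N : ℝ) ^ 2 * y ≤ (c * (K * X ^ (1 + ε))) ^ 2 * y := by gcongr
      _ = c ^ 2 * K ^ 2 * (X ^ ε) ^ 2 * (X ^ 2 * y) := by
          rw [Real.rpow_add hX0, Real.rpow_one]; ring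
      _ ≤ c ^ 2 * K ^ 2 * (E * √(B * y)) * (B * c ^ 2 * (N : ℝ) ^ 2) := by gcongr
      _ = _ := by ring
  have hfin : y ≤ G * √(B * y) := le_of_mul_le_mul_left hNsq (by positivity)
  have hsq : y * y ≤ y * (G ^ 2 * B) :=
    calc y * y ≤ (G * √(B * y)) * (G * √(B * y)) := by gcongr
      _ = G ^ 2 * √(B * y) ^ 2 := by ring
      _ = _ := by rw [Real.sq_sqrt (by positivity)]; ring
  have := le_of_mul_le_mul_left hsq (by linarith)
  linarith [(Nat.cast_nonneg d : (0 : ℝ) ≤ d)]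

/-- Assuming the abc conjecture, there is no infinite Hilbert cube in the
set of powerful numbers. -/
theorem stmt_11
    (abc : ∀ ε : ℝ, 0 < ε → ∃ K : ℝ, ∀ a b c : ℕ, 0 < a → 0 < b → 0 < c →
      a + b = c → Nat.gcd a b = 1 → (c : ℝ) ≤ K * (rad (a * b * c) : ℝ) ^ (1 + ε)) :
    ¬ ∃ (a₀ : ℕ) (a : ℕ → ℕ), (∀ i, 0 < a i) ∧
      ∀ F : Finset ℕ, F.Nonempty → Powerful (a₀ + ∑ i ∈ F, a i) := by
  rintro ⟨a₀, a, ha, hF⟩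
  obtain ⟨G, hG⟩ := exists_bound_of_abc abc (ha 0) (ha 1)
  obtain ⟨k, hk⟩ := exists_nat_gt G
  set S := Finset.Ico 2 (k + a 0 + 3)
  have hS : k + a 0 + 1 ≤ ∑ i ∈ S, a i := by
    calc k + a 0 + 1 = S.card • 1 := by simp [S]
      _ ≤ _ := Finset.card_nsmul_le_sum _ _ _ fun i _ => ha i
  have hSne : S.Nonempty := ⟨2, by simp [S]⟩
  have h0 : 0 ∉ insert 1 S := by simp [S]
  have h0' : 0 ∉ S := by simp [S]
  have h1 : 1 ∉ S := by simp [S]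
  have p₁ := hF (insert 0 S) (Finset.insert_nonempty _ _)
  have p₂ := hF (insert 0 (insert 1 S)) (Finset.insert_nonempty _ _)
  rw [Finset.sum_insert h0'] at p₁
  rw [Finset.sum_insert h0, Finset.sum_insert h1] at p₂
  have := hG (a₀ + ∑ i ∈ S, a i) (by omega) (hF S hSne)
    (by convert p₁ using 1; ring) (by convert p₂ using 1; ring)
  have hle : (k : ℝ) ≤ ((a₀ + ∑ i ∈ S, a i : ℕ) : ℝ) := by exact_mod_cast (by omega)
  linarith
end

section
/- There exist positive constants M and C such that for all integers N ≥ 3 the following holds: if A₁, …, A₅ are nonempty finite sets of integers contained in [1, N] such that Aᵢ + Aⱼ ⊆ V for all distinct i, j ∈ {1,…,5}, where V is the set of pure powers, then min_{1≤i≤5} |Aᵢ| ≤ C (log N)^M. -/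
/-- The modulus at which lifting the exponent becomes available at the prime `q`. -/
def liftModulus (q : ℕ) : ℕ := if q = 2 then 4 else q

/-- The residue of the `q`-free part of `x` modulo `liftModulus q`. -/
def unitResidue (q x : ℕ) : ZMod (liftModulus q) := ((ordCompl[q] x : ℕ) : ZMod (liftModulus q))

lemma unitResidue_mul (q x y : ℕ) : unitResidue q (x * y) = unitResidue q x * unitResidue q y := by
  simp [unitResidue, Nat.ordCompl_mul]

lemma coprime_ordCompl_liftModulus {q x : ℕ} (hq : q.Prime) (hx : x ≠ 0) :
    (ordCompl[q] x).Coprime (liftModulus q) := by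
  have h := (Nat.coprime_ordCompl hq hx).symm
  unfold liftModulus
  split_ifs with h2
  · subst h2
    exact Nat.Coprime.pow_right 2 h
  · exact h

lemma isUnit_unitResidue {q x : ℕ} (hq : q.Prime) (hx : x ≠ 0) : IsUnit (unitResidue q x) :=
  (ZMod.isUnit_iff_coprime _ _).2 (coprime_ordCompl_liftModulus hq hx)

lemma min_padicValInt_le_of_add_eq {q : ℕ} [Fact q.Prime] {x y z : ℤ} (hz : z ≠ 0)
    (h : x + y = z) : min (padicValInt q x) (padicValInt q y) ≤ padicValInt q z := by
  have h1 : (q : ℤ) ^ min (padicValInt q x) (padicValInt q y) ∣ z := by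
    rw [← h]
    exact dvd_add ((pow_dvd_pow _ (min_le_left _ _)).trans (padicValInt_dvd x))
      ((pow_dvd_pow _ (min_le_right _ _)).trans (padicValInt_dvd y))
  rcases (padicValInt_dvd_iff _ _).1 h1 with h2 | h2
  · exact absurd h2 hz
  · exact h2

lemma padicValInt_neg_eq (q : ℕ) (x : ℤ) : padicValInt q (-x) = padicValInt q x := by
  simp [padicValInt]

lemma padicValInt_ultra {q : ℕ} [Fact q.Prime] {x y z : ℤ} (hx : x ≠ 0) (hy : y ≠ 0) (hz : z ≠ 0)
    (h : x + y = z) : min (padicValInt q x) (padicValInt q y) ≤ padicValInt q z ∧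
      min (padicValInt q x) (padicValInt q z) ≤ padicValInt q y ∧
      min (padicValInt q y) (padicValInt q z) ≤ padicValInt q x := by
  refine ⟨min_padicValInt_le_of_add_eq hz h, ?_, ?_⟩
  · rw [← padicValInt_neg_eq q x]
    exact min_padicValInt_le_of_add_eq hy (by linarith)
  · rw [← padicValInt_neg_eq q y]
    exact min_padicValInt_le_of_add_eq hx (by linarith)

lemma lifting_exponent {q : ℕ} (hq : q.Prime) {x y : ℤ} (hxy : (liftModulus q : ℤ) ∣ x - y)
    (hx : ¬ (q : ℤ) ∣ x) (hne : x ≠ y) {n : ℕ} (hn : n ≠ 0) (hpow : x ^ n ≠ y ^ n) :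
    padicValInt q (x ^ n - y ^ n) = padicValInt q (x - y) + padicValNat q n := by
  have := Fact.mk hq
  have key : emultiplicity (q : ℤ) (x ^ n - y ^ n) =
      emultiplicity (q : ℤ) (x - y) + emultiplicity q n := by
    unfold liftModulus at hxy
    split_ifs at hxy with h2
    · subst h2
      have := Int.two_pow_sub_pow' n hxy hx
      rw [← Int.natCast_emultiplicity]
      exact this
    · exact Int.emultiplicity_pow_sub_pow hq (hq.odd_of_ne_two h2) hxy hx n
  have f (z : ℤ) (hz : z ≠ 0) : emultiplicity (q : ℤ) z = padicValInt q z := by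
    rw [padicValInt.of_ne_one_ne_zero hq.ne_one hz]
    exact (Int.finiteMultiplicity_iff.2
      ⟨by simpa using hq.ne_one, hz⟩).emultiplicity_eq_multiplicity
  have g : emultiplicity q n = padicValNat q n := by
    rw [padicValNat_eq_emultiplicity hn]
  rw [f _ (sub_ne_zero.2 hpow), f _ (sub_ne_zero.2 hne), g] at key
  exact_mod_cast key

lemma padicValInt_pow_sub_pow_of_unitResidue_eq {q : ℕ} (hq : q.Prime) {u v : ℕ}
    (hu : u ≠ 0) (hne : u ≠ v) {n : ℕ} (hn : n ≠ 0)
    (hval : padicValNat q u = padicValNat q v) (hres : unitResidue q u = unitResidue q v) :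
    padicValInt q ((u : ℤ) ^ n - (v : ℤ) ^ n) + padicValNat q u =
      n * padicValNat q u + padicValInt q ((u : ℤ) - v) + padicValNat q n := by
  have := Fact.mk hq
  set i := padicValNat q u with hi
  set u0 := ordCompl[q] u with hu0
  set v0 := ordCompl[q] v with hv0
  have hui : u = q ^ i * u0 := by
    rw [hu0, hi, ← Nat.factorization_def u hq, Nat.ordProj_mul_ordCompl_eq_self]
  have hvi : v = q ^ i * v0 := by
    rw [hv0, hval, ← Nat.factorization_def v hq, Nat.ordProj_mul_ordCompl_eq_self]
  have hne0 : u0 ≠ v0 := by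
    intro h
    exact hne (by rw [hui, hvi, h])
  have hdvd : (liftModulus q : ℤ) ∣ (u0 : ℤ) - v0 := by
    rw [← ZMod.intCast_zmod_eq_zero_iff_dvd]
    push_cast
    exact sub_eq_zero.2 hres
  have hnd : ¬ (q : ℤ) ∣ (u0 : ℤ) := by
    intro h
    exact Nat.not_dvd_ordCompl hq hu (Int.natCast_dvd_natCast.1 h)
  have hpow : (u0 : ℤ) ^ n ≠ (v0 : ℤ) ^ n := by
    intro h
    exact hne0 (Nat.pow_left_injective hn (by exact_mod_cast h))
  have hl := lifting_exponent hq hdvd hnd (by exact_mod_cast hne0) hn hpow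
  have hq0 : (q : ℤ) ≠ 0 := by exact_mod_cast hq.ne_zero
  have hqp (k : ℕ) : padicValInt q ((q : ℤ) ^ k) = k := by
    have : ((q : ℤ) ^ k) = ((q ^ k : ℕ) : ℤ) := by push_cast; rfl
    rw [this, padicValInt.of_nat, padicValNat.prime_pow]
  have e1 : (u : ℤ) ^ n - (v : ℤ) ^ n = (q : ℤ) ^ (i * n) * ((u0 : ℤ) ^ n - (v0 : ℤ) ^ n) := by
    rw [hui, hvi]
    push_cast
    ring
  have e2 : (u : ℤ) - v = (q : ℤ) ^ i * ((u0 : ℤ) - v0) := by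
    rw [hui, hvi]
    push_cast
    ring
  have hsub : (u0 : ℤ) - v0 ≠ 0 := sub_ne_zero.2 (by exact_mod_cast hne0)
  rw [e1, e2, padicValInt.mul (pow_ne_zero _ hq0) (sub_ne_zero.2 hpow),
    padicValInt.mul (pow_ne_zero _ hq0) hsub, hl, hqp, hqp]
  ring

/-- The four ultrametric triangles of a 4-cycle determine the valuation of its determinant. -/
lemma ultra_cross {E F α β γ ε : ℕ}
    (t1 : min α E ≤ ε ∧ min α ε ≤ E ∧ min E ε ≤ α)
    (t2 : min γ E ≤ β ∧ min γ β ≤ E ∧ min E β ≤ γ)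
    (t3 : min α F ≤ γ ∧ min α γ ≤ F ∧ min F γ ≤ α)
    (t4 : min ε F ≤ β ∧ min ε β ≤ F ∧ min F β ≤ ε) :
    E + F ≤ min (γ + ε) (α + β) + (min (E - α) (E - γ) + min (F - α) (F - ε)) ∧
    (min (E - α) (E - γ) + min (F - α) (F - ε) = 0 ∨
      (α + β = γ + ε ∧ E + F = α + β + (min (E - α) (E - γ) + min (F - α) (F - ε)))) := by
  rcases lt_or_ge E α with h1 | h1 <;> rcases lt_or_ge E γ with h2 | h2 <;>
  rcases lt_or_ge F α with h3 | h3 <;> rcases lt_or_ge F ε with h4 | h4 <;>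
  rcases le_total α γ with h5 | h5 <;> rcases le_total α ε with h6 | h6 <;>
  simp only [min_def] at * <;> grind

/-- The local inequality at the prime `q` for a nondegenerate 4-cycle of `n`-th powers. -/
lemma local_inequality {q : ℕ} (hq : q.Prime) {n : ℕ} (hn : n ≠ 0) {a a' b b' : ℤ}
    {x y z w : ℕ} (hx0 : x ≠ 0) (hy0 : y ≠ 0) (hz0 : z ≠ 0) (hw0 : w ≠ 0)
    (hx : (x : ℤ) ^ n = a' + b) (hy : (y : ℤ) ^ n = a + b)
    (hz : (z : ℤ) ^ n = a' + b') (hw : (w : ℤ) ^ n = a + b') (ha : a ≠ a') (hb : b ≠ b') :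
    padicValInt q (a' - a) + padicValInt q (b' - b) +
      n * (if unitResidue q (x * w) = unitResidue q (y * z) then
        min (padicValInt q (a' - a) - padicValInt q (a + b))
          (padicValInt q (a' - a) - padicValInt q (a + b')) +
        min (padicValInt q (b' - b) - padicValInt q (a + b))
          (padicValInt q (b' - b) - padicValInt q (a' + b)) else 0) ≤
    n * (padicValInt q ((x * w : ℕ) - (y * z : ℕ) : ℤ) + padicValNat q n) +
      (min (padicValInt q (a' - a) - padicValInt q (a + b))
          (padicValInt q (a' - a) - padicValInt q (a + b')) +
        min (padicValInt q (b' - b) - padicValInt q (a + b))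
          (padicValInt q (b' - b) - padicValInt q (a' + b))) := by
  have := Fact.mk hq
  have ha0 : a' - a ≠ 0 := sub_ne_zero.2 ha.symm
  have hb0 : b' - b ≠ 0 := sub_ne_zero.2 hb.symm
  have pz {t : ℕ} (ht : t ≠ 0) : (t : ℤ) ^ n ≠ 0 := pow_ne_zero _ (by exact_mod_cast ht)
  have vp (t : ℕ) : padicValInt q ((t : ℤ) ^ n) = n * padicValNat q t := by
    have : (t : ℤ) ^ n = ((t ^ n : ℕ) : ℤ) := by push_cast; rfl
    rw [this, padicValInt.of_nat, padicValNat.pow]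
  have vx := vp x
  have vy := vp y
  have vz := vp z
  have vw := vp w
  have nx := pz hx0
  have ny := pz hy0
  have nz := pz hz0
  have nw := pz hw0
  have hD : ((x * w : ℕ) : ℤ) ^ n - ((y * z : ℕ) : ℤ) ^ n = (a' - a) * (b' - b) := by
    push_cast
    rw [mul_pow, mul_pow, hx, hy, hz, hw]
    ring
  rw [hx] at vx nx
  rw [hy] at vy ny
  rw [hz] at vz nz
  rw [hw] at vw nw
  have t1 := padicValInt_ultra (q := q) ny ha0 nx (by ring)
  have t2 := padicValInt_ultra (q := q) nw ha0 nz (by ring)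
  have t3 := padicValInt_ultra (q := q) ny hb0 nw (by ring)
  have t4 := padicValInt_ultra (q := q) nx hb0 nz (by ring)
  have vD := congrArg (padicValInt q) hD
  rw [padicValInt.mul ha0 hb0] at vD
  have huv : x * w ≠ y * z := by
    intro h
    rw [h, sub_self] at hD
    exact mul_ne_zero ha0 hb0 hD.symm
  have hu0 : x * w ≠ 0 := mul_ne_zero hx0 hw0
  have hv0 : y * z ≠ 0 := mul_ne_zero hy0 hz0
  have hmul1 : padicValNat q (x * w) = padicValNat q x + padicValNat q w := padicValNat.mul hx0 hw0
  have hmul2 : padicValNat q (y * z) = padicValNat q y + padicValNat q z := padicValNat.mul hy0 hz0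
  have m1 : n * padicValNat q (x * w) = padicValInt q (a' + b) + padicValInt q (a + b') := by
    rw [hmul1, vx, vw]; ring
  have m2 : n * padicValNat q (y * z) = padicValInt q (a + b) + padicValInt q (a' + b') := by
    rw [hmul2, vy, vz]; ring
  have hmin := (padicValInt_ultra (q := q) (x := ((x * w : ℕ) : ℤ) - (y * z : ℕ))
    (y := ((y * z : ℕ) : ℤ)) (z := ((x * w : ℕ) : ℤ))
    (sub_ne_zero.2 (by exact_mod_cast huv)) (by exact_mod_cast hv0) (by exact_mod_cast hu0)
    (by ring)).2.2
  rw [padicValInt.of_nat, padicValInt.of_nat] at hmin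
  have hLTE := padicValInt_pow_sub_pow_of_unitResidue_eq hq hu0 huv hn
  rw [vD] at hLTE
  clear hD vD hx hy hz hw vp pz
  generalize padicValInt q (a' - a) = E at *
  generalize padicValInt q (b' - b) = F at *
  generalize padicValInt q (a + b) = α at *
  generalize padicValInt q (a' + b') = β at *
  generalize padicValInt q (a + b') = γ at *
  generalize padicValInt q (a' + b) = ε at *
  generalize padicValInt q (((x * w : ℕ) : ℤ) - (y * z : ℕ)) = s at *
  generalize padicValNat q (x * w) = i at *
  generalize padicValNat q (y * z) = j at *
  generalize padicValNat q n = t at *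
  obtain ⟨hgen, hcase⟩ := ultra_cross t1 t2 t3 t4
  generalize min (E - α) (E - γ) + min (F - α) (F - ε) = r at *
  have hs : min (γ + ε) (α + β) ≤ n * s := by
    rw [add_comm γ ε, ← m1, ← m2]
    rcases min_le_iff.1 hmin with h | h
    · exact (min_le_right _ _).trans (Nat.mul_le_mul_left n h)
    · exact (min_le_left _ _).trans (Nat.mul_le_mul_left n h)
  split_ifs with hc
  · rcases hcase with hr | ⟨h1, h2⟩
    · subst hr
      nlinarith [Nat.zero_le (n * t)]
    · have hij : i = j := by
        have : n * i = n * j := by omega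
        exact Nat.eq_of_mul_eq_mul_left (Nat.pos_of_ne_zero hn) this
      have h3 := hLTE hij hc
      have h4 : s + t = i + r := by omega
      rw [h4, mul_add]
      omega
  · nlinarith [Nat.zero_le (n * t)]

lemma sq_card_le_mul_card_collisions {ι κ : Type*} [DecidableEq κ] (s : Finset ι)
    (g : ι → κ) {p : ℕ} (h : (s.image g).card ≤ p) :
    s.card ^ 2 ≤ p * ∑ b ∈ s, ∑ b' ∈ s, if g b = g b' then 1 else 0 := by
  have h1 : s.card = ∑ y ∈ s.image g, (s.filter (fun b => g b = y)).card :=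
    Finset.card_eq_sum_card_image g s
  have h2 : ∑ b ∈ s, ∑ b' ∈ s, (if g b = g b' then 1 else 0) =
      ∑ y ∈ s.image g, (s.filter (fun b => g b = y)).card ^ 2 := by
    rw [← Finset.sum_fiberwise_of_maps_to (t := s.image g) (g := g)
      (fun x hx => Finset.mem_image_of_mem g hx)]
    refine Finset.sum_congr rfl fun y _ => ?_
    rw [sq, ← smul_eq_mul, ← Finset.sum_const]
    refine Finset.sum_congr rfl fun b hb => ?_
    rw [Finset.mem_filter] at hb
    rw [Finset.card_filter, hb.2]
    exact Finset.sum_congr rfl fun b' _ => by simp [eq_comm]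
  rw [h2, h1]
  exact sq_sum_le_card_mul_sum_sq.trans (Nat.mul_le_mul_right _ h)

lemma min_eq_sum_range {K r t : ℕ} (hr : r ≤ K) :
    min r t = ∑ k ∈ Finset.range K, if k < r ∧ k < t then 1 else 0 := by
  rw [← Finset.card_filter]
  have : (Finset.range K).filter (fun k => k < r ∧ k < t) = Finset.range (min r t) := by
    ext k
    simp only [Finset.mem_filter, Finset.mem_range, lt_min_iff]
    omega
  rw [this, Finset.card_range]

lemma sum_min_le_mul_sum_min_collisions {ι κ : Type*} [DecidableEq κ] (s : Finset ι)
    (r : ι → ℕ) (g : ι → κ) {p : ℕ} (h : ((s.filter (fun b => 0 < r b)).image g).card ≤ p) :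
    ∑ b ∈ s, ∑ b' ∈ s, min (r b) (r b') ≤
      p * ∑ b ∈ s, ∑ b' ∈ s, if g b = g b' then min (r b) (r b') else 0 := by
  set K := s.sup r with hK
  have hr (b : ι) (hb : b ∈ s) : r b ≤ K := Finset.le_sup hb
  have e1 : ∑ b ∈ s, ∑ b' ∈ s, min (r b) (r b') =
      ∑ k ∈ Finset.range K, (s.filter (fun b => k < r b)).card ^ 2 := by
    have : ∀ b ∈ s, ∑ b' ∈ s, min (r b) (r b') = ∑ k ∈ Finset.range K, ∑ b' ∈ s,
        if k < r b ∧ k < r b' then 1 else 0 := by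
      intro b hb
      rw [Finset.sum_comm]
      exact Finset.sum_congr rfl fun b' _ => min_eq_sum_range (hr b hb)
    rw [Finset.sum_congr rfl this, Finset.sum_comm]
    refine Finset.sum_congr rfl fun k _ => ?_
    rw [sq, Finset.card_filter, Finset.sum_mul_sum]
    refine Finset.sum_congr rfl fun b _ => Finset.sum_congr rfl fun b' _ => ?_
    by_cases h1 : k < r b <;> by_cases h2 : k < r b' <;> simp [h1, h2]
  have e2 : ∑ b ∈ s, ∑ b' ∈ s, (if g b = g b' then min (r b) (r b') else 0) =
      ∑ k ∈ Finset.range K, ∑ b ∈ s.filter (fun b => k < r b),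
        ∑ b' ∈ s.filter (fun b => k < r b), if g b = g b' then 1 else 0 := by
    have : ∀ b ∈ s, ∑ b' ∈ s, (if g b = g b' then min (r b) (r b') else 0) =
        ∑ k ∈ Finset.range K, ∑ b' ∈ s,
        if k < r b ∧ k < r b' then (if g b = g b' then 1 else 0) else 0 := by
      intro b hb
      rw [Finset.sum_comm]
      refine Finset.sum_congr rfl fun b' _ => ?_
      split_ifs with hg
      · exact min_eq_sum_range (hr b hb)
      · simp
    rw [Finset.sum_congr rfl this, Finset.sum_comm]
    refine Finset.sum_congr rfl fun k _ => ?_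
    rw [Finset.sum_filter]
    refine Finset.sum_congr rfl fun b _ => ?_
    rw [Finset.sum_filter]
    by_cases h1 : k < r b <;> simp [h1]
  rw [e1, e2, Finset.mul_sum]
  refine Finset.sum_le_sum fun k _ => sq_card_le_mul_card_collisions _ g (le_trans ?_ h)
  refine Finset.card_le_card (Finset.image_subset_image fun b hb => ?_)
  rw [Finset.mem_filter] at hb ⊢
  exact ⟨hb.1, by omega⟩

lemma exists_label_set {q : ℕ} (hq : q.Prime) {n : ℕ} (hn : 2 ≤ n) :
    ∃ L : Finset (ZMod (liftModulus q)), L.card ≤ n ∧ ∀ x y : ℕ, x ≠ 0 → y ≠ 0 →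
      (x : ℤ) ^ n ≠ (y : ℤ) ^ n →
      padicValInt q ((y : ℤ) ^ n) < padicValInt q ((x : ℤ) ^ n - (y : ℤ) ^ n) →
      unitResidue q x * (unitResidue q y)⁻¹ ∈ L := by
  have := Fact.mk hq
  by_cases h2 : q = 2
  · subst h2
    have hu : ∀ t : ZMod 4, IsUnit t → t ∈ ({1, 3} : Finset (ZMod 4)) := by decide
    refine ⟨({1, 3} : Finset (ZMod 4)), le_trans (by decide) hn, fun x y hx hy _ _ => hu _ ?_⟩
    obtain ⟨t, ht⟩ := isUnit_unitResidue hq hy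
    have h3 : IsUnit (unitResidue 2 y)⁻¹ := by
      rw [← ht, ZMod.inv_coe_unit]
      exact Units.isUnit _
    exact (isUnit_unitResidue hq hx).mul h3
  · have hQ : liftModulus q = q := by simp [liftModulus, h2]
    have : Fact (liftModulus q).Prime := ⟨by rw [hQ]; exact hq⟩
    refine ⟨(Polynomial.nthRoots n (1 : ZMod (liftModulus q))).toFinset,
      (Multiset.toFinset_card_le _).trans (Polynomial.card_nthRoots _ _), ?_⟩
    intro x y hx hy hne hlt
    rw [Multiset.mem_toFinset, Polynomial.mem_nthRoots (by omega)]
    have hy' := (isUnit_unitResidue hq hy).ne_zero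
    rw [mul_pow, inv_pow]
    refine mul_inv_eq_one₀ (pow_ne_zero _ hy') |>.2 ?_
    have nx : (x : ℤ) ^ n ≠ 0 := pow_ne_zero _ (by exact_mod_cast hx)
    have ny : (y : ℤ) ^ n ≠ 0 := pow_ne_zero _ (by exact_mod_cast hy)
    have hu := padicValInt_ultra (q := q) ny (sub_ne_zero.2 hne) nx (by ring)
    have hval : padicValInt q ((x : ℤ) ^ n) = padicValInt q ((y : ℤ) ^ n) := by omega
    have vp (t : ℕ) : padicValInt q ((t : ℤ) ^ n) = n * padicValNat q t := by
      have : (t : ℤ) ^ n = ((t ^ n : ℕ) : ℤ) := by push_cast; rfl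
      rw [this, padicValInt.of_nat, padicValNat.pow]
    rw [vp, vp] at hval
    have hval' : padicValNat q x = padicValNat q y :=
      Nat.eq_of_mul_eq_mul_left (by omega) hval
    rw [vp] at hlt
    set i := padicValNat q y with hi
    have hxi : x = q ^ i * ordCompl[q] x := by
      rw [← hval', ← Nat.factorization_def x hq, Nat.ordProj_mul_ordCompl_eq_self]
    have hyi : y = q ^ i * ordCompl[q] y := by
      rw [hi, ← Nat.factorization_def y hq, Nat.ordProj_mul_ordCompl_eq_self]
    have hdvd : (q : ℤ) ^ (n * i + 1) ∣ (x : ℤ) ^ n - (y : ℤ) ^ n :=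
      (pow_dvd_pow _ hlt).trans (padicValInt_dvd _)
    have hfac : (x : ℤ) ^ n - (y : ℤ) ^ n = (q : ℤ) ^ (n * i) *
        (((ordCompl[q] x : ℕ) : ℤ) ^ n - ((ordCompl[q] y : ℕ) : ℤ) ^ n) := by
      conv_lhs => rw [hxi, hyi]
      rw [Nat.cast_mul, Nat.cast_mul, Nat.cast_pow]
      ring
    rw [hfac, pow_succ] at hdvd
    have hdvd' := (mul_dvd_mul_iff_left
      (pow_ne_zero _ (by exact_mod_cast hq.ne_zero : (q : ℤ) ≠ 0))).1 hdvd
    have hdvd'' : ((liftModulus q : ℕ) : ℤ) ∣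
        (((ordCompl[q] x : ℕ) : ℤ) ^ n - ((ordCompl[q] y : ℕ) : ℤ) ^ n) := by
      rw [hQ]
      exact hdvd'
    rw [← ZMod.intCast_zmod_eq_zero_iff_dvd, Int.cast_sub, Int.cast_pow, Int.cast_pow,
      Int.cast_natCast, Int.cast_natCast, sub_eq_zero] at hdvd''
    exact hdvd''

/-- The elements of `B` joined to both coordinates of `i` in the graph `(X a b) ^ n = a + b`. -/
def commonNeighbors (X : ℤ → ℤ → ℕ) (n : ℕ) (B : Finset ℤ) (i : ℤ × ℤ) : Finset ℤ :=
  B.filter fun b => (X i.1 b : ℤ) ^ n = i.1 + b ∧ (X i.2 b : ℤ) ^ n = i.2 + b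

lemma ne_zero_of_pow_eq {n x : ℕ} (hn : n ≠ 0) {c : ℤ} (hc : 0 < c) (h : (x : ℤ) ^ n = c) :
    x ≠ 0 := by
  rintro rfl
  simp [hn] at h
  omega

lemma sum_offDiag_add_diag {ι : Type*} [DecidableEq ι] (s : Finset ι) (f : ι → ι → ℕ) :
    ∑ b ∈ s, ∑ b' ∈ s, f b b' = ∑ j ∈ s.offDiag, f j.1 j.2 + ∑ b ∈ s, f b b := by
  rw [← Finset.sum_product', ← Finset.diag_union_offDiag,
    Finset.sum_union (Finset.disjoint_diag_offDiag s), add_comm, Finset.sum_diag]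

lemma sum_min_offDiag_le {q : ℕ} (hq : q.Prime) {n : ℕ} (hn : 2 ≤ n) (X : ℤ → ℤ → ℕ)
    (B : Finset ℤ) (hB : ∀ b ∈ B, 0 < b) {a a' : ℤ} (ha : 0 < a) (ha' : 0 < a') (hne : a ≠ a') :
    ∑ j ∈ (commonNeighbors X n B (a, a')).offDiag,
      min (padicValInt q (a' - a) - padicValInt q (a + j.1))
        (padicValInt q (a' - a) - padicValInt q (a + j.2)) ≤
    n * (∑ j ∈ (commonNeighbors X n B (a, a')).offDiag,
      if unitResidue q (X a' j.1 * X a j.2) = unitResidue q (X a j.1 * X a' j.2) then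
        min (padicValInt q (a' - a) - padicValInt q (a + j.1))
        (padicValInt q (a' - a) - padicValInt q (a + j.2)) else 0) +
    n * (B.card * padicValInt q (a' - a)) := by
  classical
  obtain ⟨L, hL, hlab⟩ := exists_label_set hq hn
  set s := commonNeighbors X n B (a, a') with hs
  have hmem : ∀ b ∈ s, (X a b : ℤ) ^ n = a + b ∧ (X a' b : ℤ) ^ n = a' + b ∧
      X a b ≠ 0 ∧ X a' b ≠ 0 := by
    intro b hb
    rw [hs, commonNeighbors, Finset.mem_filter] at hb
    have := hB b hb.1
    exact ⟨hb.2.1, hb.2.2, ne_zero_of_pow_eq (by omega) (by omega) hb.2.1,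
      ne_zero_of_pow_eq (by omega) (by omega) hb.2.2⟩
  set r : ℤ → ℕ := fun b => padicValInt q (a' - a) - padicValInt q (a + b) with hr
  have key := sum_min_le_mul_sum_min_collisions s r
    (fun b => unitResidue q (X a' b) * (unitResidue q (X a b))⁻¹) (p := n) (by
      refine le_trans (Finset.card_le_card ?_) hL
      intro t ht
      rw [Finset.mem_image] at ht
      obtain ⟨b, hb, rfl⟩ := ht
      rw [Finset.mem_filter] at hb
      obtain ⟨h1, h2, h3, h4⟩ := hmem b hb.1
      refine hlab _ _ h4 h3 (by rw [h1, h2]; omega) ?_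
      rw [h1, h2, show a' + b - (a + b) = a' - a by ring]
      have := hb.2
      simp only [hr] at this
      omega)
  have hcond : ∀ b ∈ s, ∀ b' ∈ s, (unitResidue q (X a' b) * (unitResidue q (X a b))⁻¹ =
      unitResidue q (X a' b') * (unitResidue q (X a b'))⁻¹ ↔
      unitResidue q (X a' b * X a b') = unitResidue q (X a b * X a' b')) := by
    intro b hb b' hb'
    obtain ⟨u, hu⟩ := isUnit_unitResidue hq (hmem b hb).2.2.1
    obtain ⟨v, hv⟩ := isUnit_unitResidue hq (hmem b' hb').2.2.1
    rw [unitResidue_mul, unitResidue_mul, ← hu, ← hv, ZMod.inv_coe_unit, ZMod.inv_coe_unit,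
      Units.mul_inv_eq_iff_eq_mul, mul_right_comm, eq_comm, Units.mul_inv_eq_iff_eq_mul,
      mul_comm (u : ZMod (liftModulus q))]
    exact eq_comm
  have e : ∑ b ∈ s, ∑ b' ∈ s, (if unitResidue q (X a' b) * (unitResidue q (X a b))⁻¹ =
      unitResidue q (X a' b') * (unitResidue q (X a b'))⁻¹ then min (r b) (r b') else 0) =
      ∑ b ∈ s, ∑ b' ∈ s, (if unitResidue q (X a' b * X a b') = unitResidue q (X a b * X a' b')
        then min (r b) (r b') else 0) := by
    refine Finset.sum_congr rfl fun b hb => Finset.sum_congr rfl fun b' hb' => ?_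
    simp only [hcond b hb b' hb']
  rw [e, sum_offDiag_add_diag, sum_offDiag_add_diag, mul_add] at key
  refine (Nat.le_add_right _ _).trans (key.trans (Nat.add_le_add_left ?_ _))
  refine Nat.mul_le_mul_left _ ?_
  calc _ ≤ ∑ b ∈ s, padicValInt q (a' - a) := by
        refine Finset.sum_le_sum fun b _ => ?_
        split_ifs
        · simp [hr]
        · exact Nat.zero_le _
    _ = s.card * padicValInt q (a' - a) := by simp
    _ ≤ _ := Nat.mul_le_mul_right _ (Finset.card_le_card (Finset.filter_subset _ _))

lemma sum_offDiag_swap {R : Type*} [AddCommMonoid R] (X : ℤ → ℤ → ℕ) (n : ℕ) (A B : Finset ℤ)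
    (f : ℤ × ℤ → ℤ × ℤ → R) :
    ∑ i ∈ A.offDiag, ∑ j ∈ (commonNeighbors X n B i).offDiag, f i j =
      ∑ j ∈ B.offDiag, ∑ i ∈ (commonNeighbors (fun b a => X a b) n A j).offDiag, f i j := by
  refine Finset.sum_comm' fun i j => ?_
  simp only [commonNeighbors, Finset.mem_offDiag, Finset.mem_filter]
  rw [add_comm j.1 i.1, add_comm j.1 i.2, add_comm j.2 i.1, add_comm j.2 i.2]
  tauto

lemma sum_valuation_le {q : ℕ} (hq : q.Prime) {n : ℕ} (hn : 2 ≤ n) (X : ℤ → ℤ → ℕ)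
    (A B : Finset ℤ) (hA : ∀ a ∈ A, 0 < a) (hB : ∀ b ∈ B, 0 < b) :
    ∑ i ∈ A.offDiag, ∑ j ∈ (commonNeighbors X n B i).offDiag,
      (padicValInt q (i.2 - i.1) + padicValInt q (j.2 - j.1)) ≤
    ∑ i ∈ A.offDiag, ∑ j ∈ (commonNeighbors X n B i).offDiag,
      n * (padicValInt q ((X i.2 j.1 * X i.1 j.2 : ℕ) - (X i.1 j.1 * X i.2 j.2 : ℕ) : ℤ) +
        padicValNat q n) +
    n * (B.card * ∑ i ∈ A.offDiag, padicValInt q (i.2 - i.1) +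
      A.card * ∑ j ∈ B.offDiag, padicValInt q (j.2 - j.1)) := by
  classical
  set e : ℤ × ℤ → ℤ × ℤ → ℕ := fun i j =>
    min (padicValInt q (i.2 - i.1) - padicValInt q (i.1 + j.1))
      (padicValInt q (i.2 - i.1) - padicValInt q (i.1 + j.2)) with he
  set f : ℤ × ℤ → ℤ × ℤ → ℕ := fun i j =>
    min (padicValInt q (j.2 - j.1) - padicValInt q (i.1 + j.1))
      (padicValInt q (j.2 - j.1) - padicValInt q (i.2 + j.1)) with hf
  set c : ℤ × ℤ → ℤ × ℤ → Prop := fun i j =>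
    unitResidue q (X i.2 j.1 * X i.1 j.2) = unitResidue q (X i.1 j.1 * X i.2 j.2) with hc
  have h1 : ∑ i ∈ A.offDiag, ∑ j ∈ (commonNeighbors X n B i).offDiag, e i j ≤
      n * (∑ i ∈ A.offDiag, ∑ j ∈ (commonNeighbors X n B i).offDiag,
        if c i j then e i j else 0) +
      n * (B.card * ∑ i ∈ A.offDiag, padicValInt q (i.2 - i.1)) := by
    simp only [Finset.mul_sum, ← Finset.sum_add_distrib]
    refine Finset.sum_le_sum fun i hi => ?_
    rw [Finset.mem_offDiag] at hi
    have := sum_min_offDiag_le hq hn X B hB (hA _ hi.1) (hA _ hi.2.1) hi.2.2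
    rw [Finset.mul_sum] at this
    exact this
  have h2 : ∑ i ∈ A.offDiag, ∑ j ∈ (commonNeighbors X n B i).offDiag, f i j ≤
      n * (∑ i ∈ A.offDiag, ∑ j ∈ (commonNeighbors X n B i).offDiag,
        if c i j then f i j else 0) +
      n * (A.card * ∑ j ∈ B.offDiag, padicValInt q (j.2 - j.1)) := by
    rw [sum_offDiag_swap X n A B f,
      sum_offDiag_swap X n A B (fun i j => if c i j then f i j else 0)]
    simp only [Finset.mul_sum, ← Finset.sum_add_distrib]
    refine Finset.sum_le_sum fun j hj => ?_
    rw [Finset.mem_offDiag] at hj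
    have := sum_min_offDiag_le hq hn (fun b a => X a b) A hA (hB _ hj.1) (hB _ hj.2.1) hj.2.2
    rw [Finset.mul_sum] at this
    simp only [hc, hf]
    simp only [add_comm j.1, fun x : ℤ × ℤ => mul_comm (X x.1 j.2) (X x.2 j.1)] at this
    exact this
  have h3 : ∑ i ∈ A.offDiag, ∑ j ∈ (commonNeighbors X n B i).offDiag,
      (padicValInt q (i.2 - i.1) + padicValInt q (j.2 - j.1) +
        n * (if c i j then e i j + f i j else 0)) ≤
      ∑ i ∈ A.offDiag, ∑ j ∈ (commonNeighbors X n B i).offDiag,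
      (n * (padicValInt q ((X i.2 j.1 * X i.1 j.2 : ℕ) - (X i.1 j.1 * X i.2 j.2 : ℕ) : ℤ) +
        padicValNat q n) + (e i j + f i j)) := by
    refine Finset.sum_le_sum fun i hi => Finset.sum_le_sum fun j hj => ?_
    simp only [commonNeighbors, Finset.mem_offDiag, Finset.mem_filter] at hi hj
    have p1 := hA _ hi.1
    have p2 := hA _ hi.2.1
    have p3 := hB _ hj.1.1
    have p4 := hB _ hj.2.1.1
    exact local_inequality hq (by omega)
      (ne_zero_of_pow_eq (by omega) (by omega) hj.1.2.2)
      (ne_zero_of_pow_eq (by omega) (by omega) hj.1.2.1)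
      (ne_zero_of_pow_eq (by omega) (by omega) hj.2.1.2.2)
      (ne_zero_of_pow_eq (by omega) (by omega) hj.2.1.2.1)
      hj.1.2.2 hj.1.2.1 hj.2.1.2.2 hj.2.1.2.1 hi.2.2 hj.2.2
  have h4 : ∀ i j, (if c i j then e i j + f i j else 0) =
      (if c i j then e i j else 0) + (if c i j then f i j else 0) := by
    intro i j
    split_ifs <;> rfl
  simp only [h4, Finset.sum_add_distrib, mul_add, ← Finset.mul_sum] at h1 h2 h3 ⊢
  linarith

lemma log_int_eq_sum_padicValInt {z : ℤ} {K : ℕ} (hK : z.natAbs ≤ K) :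
    Real.log z = ∑ q ∈ (Finset.range (K + 1)).filter Nat.Prime,
      (padicValInt q z : ℝ) * Real.log q := by
  have h1 : Real.log z = Real.log (z.natAbs : ℝ) := by
    rw [Nat.cast_natAbs, Int.cast_abs, Real.log_abs]
  rw [h1, Real.log_nat_eq_sum_factorization,
    Finsupp.sum_of_support_subset (s := (Finset.range (K + 1)).filter Nat.Prime)]
  · refine Finset.sum_congr rfl fun q hq => ?_
    rw [Finset.mem_filter] at hq
    rw [Nat.factorization_def _ hq.2]
    rfl
  · intro q hq
    rw [Nat.support_factorization, Nat.mem_primeFactors] at hq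
    rw [Finset.mem_filter, Finset.mem_range]
    have := Nat.le_of_dvd (Nat.pos_of_ne_zero hq.2.2) hq.2.1
    exact ⟨by omega, hq.1⟩
  · simp

lemma mul_pow_min_le_abs_pow_sub_pow {u v : ℝ} (hu : 0 ≤ u) (hv : 0 ≤ v) (n : ℕ) :
    |u - v| * (n * min u v ^ (n - 1)) ≤ |u ^ n - v ^ n| := by
  have hm : 0 ≤ min u v := le_min hu hv
  rw [← geom_sum₂_mul, abs_mul, mul_comm]
  refine mul_le_mul_of_nonneg_right (le_trans ?_ (le_abs_self _)) (abs_nonneg _)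
  calc (n : ℝ) * min u v ^ (n - 1) = ∑ i ∈ Finset.range n, min u v ^ i * min u v ^ (n - 1 - i) := by
        rw [Finset.sum_congr rfl (g := fun _ => min u v ^ (n - 1))]
        · simp
        · intro i hi
          rw [Finset.mem_range] at hi
          rw [← pow_add]
          congr 1
          omega
    _ ≤ _ := Finset.sum_le_sum fun i _ => mul_le_mul (pow_le_pow_left₀ hm (min_le_left _ _) _)
        (pow_le_pow_left₀ hm (min_le_right _ _) _) (pow_nonneg hm _) (pow_nonneg hu _)

lemma log_sub_add_log_le {u v : ℕ} (hu : u ≠ 0) (hv : v ≠ 0) (hne : u ≠ v) {n : ℕ} (hn : n ≠ 0)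
    {D : ℝ} (hD : (u : ℝ) ^ n - (v : ℝ) ^ n = D) (h1 : 2 * |D| ≤ (u : ℝ) ^ n)
    (h2 : 2 * |D| ≤ (v : ℝ) ^ n) :
    n * (Real.log ((u : ℝ) - v) + Real.log n) ≤ Real.log D - (n - 1) * Real.log 2 := by
  have hu' : (0 : ℝ) < u := by positivity
  have hv' : (0 : ℝ) < v := by positivity
  have hn' : (0 : ℝ) < n := by positivity
  have hn1 : (0 : ℝ) ≤ (n : ℝ) - 1 := by
    have : (1 : ℝ) ≤ n := by exact_mod_cast Nat.one_le_iff_ne_zero.2 hn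
    linarith
  have hm : 0 < min (u : ℝ) v := lt_min hu' hv'
  have hsub : 0 < |(u : ℝ) - v| := abs_pos.2 (sub_ne_zero.2 (by exact_mod_cast hne))
  have hmain := mul_pow_min_le_abs_pow_sub_pow hu'.le hv'.le n
  rw [hD] at hmain
  have hDpos : 0 < |D| := lt_of_lt_of_le (by positivity) hmain
  have h3 := Real.log_le_log (by positivity) hmain
  rw [Real.log_mul hsub.ne' (by positivity), Real.log_mul hn'.ne' (by positivity), Real.log_pow,
    Real.log_abs, Real.log_abs, Nat.cast_sub (Nat.one_le_iff_ne_zero.2 hn), Nat.cast_one] at h3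
  have h4 : 2 * |D| ≤ min (u : ℝ) v ^ n := by
    rcases min_choice (u : ℝ) v with h | h <;> rw [h] <;> assumption
  have h5 := Real.log_le_log (by positivity) h4
  rw [Real.log_mul two_ne_zero hDpos.ne', Real.log_abs, Real.log_pow] at h5
  nlinarith [mul_le_mul_of_nonneg_left h5 hn1, mul_le_mul_of_nonneg_left h3 hn'.le]

lemma two_mul_abs_mul_le {a a' b b' : ℤ} (ha : 0 < a) (ha' : 0 < a') (hb : 0 < b) (hb' : 0 < b')
    (h : 2 * |a' - a| ≤ a) (h' : 2 * |a' - a| ≤ a') :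
    2 * |(a' - a) * (b' - b)| ≤ (a' + b) * (a + b') := by
  rw [abs_mul, ← mul_assoc]
  rcases le_total b b' with hbb | hbb
  · rw [abs_of_nonneg (sub_nonneg.2 hbb)]
    exact mul_le_mul (by linarith) (by linarith) (by linarith) (by linarith)
  · rw [abs_of_nonpos (sub_nonpos.2 hbb), mul_comm (a' + b)]
    exact mul_le_mul (by linarith) (by linarith) (by linarith) (by linarith)

lemma sum_log_le {n : ℕ} (hn : 2 ≤ n) (X : ℤ → ℤ → ℕ) {A B : Finset ℤ} {N : ℕ}
    (hA : ∀ a ∈ A, 1 ≤ a ∧ a ≤ (N : ℤ)) (hB : ∀ b ∈ B, 1 ≤ b ∧ b ≤ (N : ℤ)) :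
    ∑ i ∈ A.offDiag, ∑ j ∈ (commonNeighbors X n B i).offDiag,
      Real.log (((i.2 - i.1) * (j.2 - j.1) : ℤ) : ℝ) ≤
    ∑ i ∈ A.offDiag, ∑ j ∈ (commonNeighbors X n B i).offDiag,
      n * (Real.log (((X i.2 j.1 * X i.1 j.2 : ℕ) : ℝ) - (X i.1 j.1 * X i.2 j.2 : ℕ)) +
        Real.log n) +
    n * (A.card * B.card * (A.card + B.card) * Real.log N) := by
  set K := N * N + n with hK
  set Q := (Finset.range (K + 1)).filter Nat.Prime with hQ
  have hdiff : ∀ S : Finset ℤ, (∀ a ∈ S, 1 ≤ a ∧ a ≤ (N : ℤ)) → ∀ i ∈ S.offDiag,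
      i.2 - i.1 ≠ 0 ∧ (i.2 - i.1).natAbs ≤ N := by
    intro S hS i hi
    rw [Finset.mem_offDiag] at hi
    have h1 := hS _ hi.1
    have h2 := hS _ hi.2.1
    have h3 := hi.2.2
    constructor
    · intro h; omega
    · omega
  have hNK : N ≤ K := by rw [hK]; nlinarith [Nat.zero_le n, Nat.le_mul_self N]
  have hlogdiff : ∀ S : Finset ℤ, (∀ a ∈ S, 1 ≤ a ∧ a ≤ (N : ℤ)) →
      ∑ i ∈ S.offDiag, ∑ q ∈ Q, (padicValInt q (i.2 - i.1) : ℝ) * Real.log q ≤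
        S.card * S.card * Real.log N := by
    intro S hS
    calc _ ≤ ∑ i ∈ S.offDiag, Real.log N := by
          refine Finset.sum_le_sum fun i hi => ?_
          obtain ⟨h1, h2⟩ := hdiff S hS i hi
          rw [← log_int_eq_sum_padicValInt (h2.trans hNK), ← Real.log_abs, ← Int.cast_abs,
            ← Nat.cast_natAbs]
          exact Real.log_le_log (by exact_mod_cast Int.natAbs_pos.2 h1) (by exact_mod_cast h2)
      _ = S.offDiag.card * Real.log N := by simp
      _ ≤ _ := by
          refine mul_le_mul_of_nonneg_right ?_ (Real.log_natCast_nonneg N)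
          rw [Finset.offDiag_card]
          exact_mod_cast Nat.sub_le _ _
  have hC : ∀ i ∈ A.offDiag, ∀ j ∈ (commonNeighbors X n B i).offDiag,
      j ∈ B.offDiag ∧ ((X i.2 j.1 * X i.1 j.2 : ℕ) : ℤ) ^ n -
        ((X i.1 j.1 * X i.2 j.2 : ℕ) : ℤ) ^ n = (i.2 - i.1) * (j.2 - j.1) := by
    intro i hi j hj
    simp only [commonNeighbors, Finset.mem_offDiag, Finset.mem_filter] at hi hj
    refine ⟨Finset.mem_offDiag.2 ⟨hj.1.1, hj.2.1.1, hj.2.2⟩, ?_⟩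
    push_cast
    rw [mul_pow, mul_pow, hj.1.2.1, hj.1.2.2, hj.2.1.2.1, hj.2.1.2.2]
    ring
  have hL : ∑ i ∈ A.offDiag, ∑ j ∈ (commonNeighbors X n B i).offDiag,
      Real.log (((i.2 - i.1) * (j.2 - j.1) : ℤ) : ℝ) = ∑ q ∈ Q, Real.log q *
      ((∑ i ∈ A.offDiag, ∑ j ∈ (commonNeighbors X n B i).offDiag,
        (padicValInt q (i.2 - i.1) + padicValInt q (j.2 - j.1)) : ℕ) : ℝ) := by
    simp only [Nat.cast_sum, Finset.mul_sum]
    rw [Finset.sum_comm]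
    refine Finset.sum_congr rfl fun i hi => ?_
    rw [Finset.sum_comm]
    refine Finset.sum_congr rfl fun j hj => ?_
    obtain ⟨h1, h2⟩ := hdiff A hA i hi
    obtain ⟨h3, h4⟩ := hdiff B hB j (hC i hi j hj).1
    rw [Int.cast_mul, Real.log_mul (by exact_mod_cast h1) (by exact_mod_cast h3),
      log_int_eq_sum_padicValInt (h2.trans hNK), log_int_eq_sum_padicValInt (h4.trans hNK),
      ← Finset.sum_add_distrib]
    refine Finset.sum_congr rfl fun q _ => ?_
    push_cast
    ring
  have hR : ∑ i ∈ A.offDiag, ∑ j ∈ (commonNeighbors X n B i).offDiag,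
      n * (Real.log (((X i.2 j.1 * X i.1 j.2 : ℕ) : ℝ) - (X i.1 j.1 * X i.2 j.2 : ℕ)) +
        Real.log n) = ∑ q ∈ Q, Real.log q *
      ((∑ i ∈ A.offDiag, ∑ j ∈ (commonNeighbors X n B i).offDiag,
        n * (padicValInt q ((X i.2 j.1 * X i.1 j.2 : ℕ) - (X i.1 j.1 * X i.2 j.2 : ℕ) : ℤ) +
        padicValNat q n) : ℕ) : ℝ) := by
    simp only [Nat.cast_sum, Finset.mul_sum]
    rw [Finset.sum_comm]
    refine Finset.sum_congr rfl fun i hi => ?_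
    rw [Finset.sum_comm]
    refine Finset.sum_congr rfl fun j hj => ?_
    obtain ⟨h1, h2⟩ := hdiff A hA i hi
    obtain ⟨hjB, hD⟩ := hC i hi j hj
    obtain ⟨h3, h4⟩ := hdiff B hB j hjB
    set u := X i.2 j.1 * X i.1 j.2
    set v := X i.1 j.1 * X i.2 j.2
    have hdvd : (u : ℤ) - v ∣ (i.2 - i.1) * (j.2 - j.1) := by
      rw [← hD]
      exact sub_dvd_pow_sub_pow _ _ _
    have hD0 : (i.2 - i.1) * (j.2 - j.1) ≠ 0 := mul_ne_zero h1 h3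
    have huv : (u : ℤ) - v ≠ 0 := fun h => hD0 (by rw [h] at hdvd; exact zero_dvd_iff.1 hdvd)
    have hle : ((u : ℤ) - v).natAbs ≤ K := by
      refine (Nat.le_of_dvd (Int.natAbs_pos.2 hD0) (Int.natAbs_dvd_natAbs.2 hdvd)).trans ?_
      rw [Int.natAbs_mul]
      exact (Nat.mul_le_mul h2 h4).trans (Nat.le_add_right _ _)
    have e1 := log_int_eq_sum_padicValInt hle
    have e2 := log_int_eq_sum_padicValInt (z := (n : ℤ)) (K := K) (by simp [hK])
    push_cast at e1 e2
    rw [e1, e2, ← Finset.sum_add_distrib, Finset.mul_sum]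
    refine Finset.sum_congr rfl fun q _ => ?_
    rw [padicValInt.of_nat]
    push_cast
    ring
  have hE : ∑ q ∈ Q, Real.log q * ((n * (B.card * ∑ i ∈ A.offDiag, padicValInt q (i.2 - i.1) +
      A.card * ∑ j ∈ B.offDiag, padicValInt q (j.2 - j.1)) : ℕ) : ℝ) =
      n * (B.card * (∑ i ∈ A.offDiag, ∑ q ∈ Q, (padicValInt q (i.2 - i.1) : ℝ) * Real.log q) +
      A.card * (∑ i ∈ B.offDiag, ∑ q ∈ Q, (padicValInt q (i.2 - i.1) : ℝ) * Real.log q)) := by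
    rw [Finset.sum_comm, Finset.sum_comm (s := B.offDiag), Finset.mul_sum, Finset.mul_sum,
      ← Finset.sum_add_distrib, Finset.mul_sum]
    refine Finset.sum_congr rfl fun q _ => ?_
    push_cast
    rw [← Finset.sum_mul, ← Finset.sum_mul]
    ring
  rw [hL, hR]
  have hA' := hlogdiff A hA
  have hB' := hlogdiff B hB
  refine (Finset.sum_le_sum (g := fun q : ℕ => Real.log q *
      ((∑ i ∈ A.offDiag, ∑ j ∈ (commonNeighbors X n B i).offDiag,
      n * (padicValInt q ((X i.2 j.1 * X i.1 j.2 : ℕ) - (X i.1 j.1 * X i.2 j.2 : ℕ) : ℤ) +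
        padicValNat q n) : ℕ) : ℝ) +
      Real.log q * ((n * (B.card * ∑ i ∈ A.offDiag, padicValInt q (i.2 - i.1) +
      A.card * ∑ j ∈ B.offDiag, padicValInt q (j.2 - j.1)) : ℕ) : ℝ)) fun q hq => ?_).trans ?_
  · rw [← mul_add, ← Nat.cast_add]
    refine mul_le_mul_of_nonneg_left ?_ (Real.log_natCast_nonneg q)
    exact_mod_cast sum_valuation_le (Finset.mem_filter.1 hq).2 hn X A B
      (fun a ha => by linarith [(hA a ha).1]) (fun b hb => by linarith [(hB b hb).1])
  · rw [Finset.sum_add_distrib, hE]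
    refine add_le_add_right (mul_le_mul_of_nonneg_left ?_ (Nat.cast_nonneg n)) _
    nlinarith [mul_le_mul_of_nonneg_left hA' (Nat.cast_nonneg (α := ℝ) B.card),
      mul_le_mul_of_nonneg_left hB' (Nat.cast_nonneg (α := ℝ) A.card)]

/-- The number of nondegenerate 4-cycles of `n`-th powers is of lower order. -/
lemma card_cycles_le {n : ℕ} (hn : 2 ≤ n) (X : ℤ → ℤ → ℕ) {A B : Finset ℤ} {N : ℕ}
    (hA : ∀ a ∈ A, 1 ≤ a ∧ a ≤ (N : ℤ)) (hB : ∀ b ∈ B, 1 ≤ b ∧ b ≤ (N : ℤ))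
    (hAA : ∀ a ∈ A, ∀ a' ∈ A, 2 * |a' - a| ≤ a) :
    ((∑ i ∈ A.offDiag, (commonNeighbors X n B i).offDiag.card : ℕ) : ℝ) * Real.log 2 ≤
      2 * (A.card * B.card * (A.card + B.card) * Real.log N) := by
  have h1 := sum_log_le hn X hA hB
  have h2 : ∑ i ∈ A.offDiag, ∑ j ∈ (commonNeighbors X n B i).offDiag,
      n * (Real.log (((X i.2 j.1 * X i.1 j.2 : ℕ) : ℝ) - (X i.1 j.1 * X i.2 j.2 : ℕ)) +
        Real.log n) ≤
      ∑ i ∈ A.offDiag, ∑ j ∈ (commonNeighbors X n B i).offDiag,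
      (Real.log (((i.2 - i.1) * (j.2 - j.1) : ℤ) : ℝ) - (n - 1) * Real.log 2) := by
    refine Finset.sum_le_sum fun i hi => Finset.sum_le_sum fun j hj => ?_
    simp only [commonNeighbors, Finset.mem_offDiag, Finset.mem_filter] at hi hj
    obtain ⟨⟨hb1, e11, e21⟩, ⟨hb2, e12, e22⟩, hjne⟩ := hj
    obtain ⟨ha1, ha2, hine⟩ := hi
    have p1 := (hA _ ha1).1
    have p2 := (hA _ ha2).1
    have p3 := (hB _ hb1).1
    have p4 := (hB _ hb2).1
    have q1 := hAA _ ha1 _ ha2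
    have q2 := hAA _ ha2 _ ha1
    have hn0 : n ≠ 0 := by omega
    have n11 := ne_zero_of_pow_eq hn0 (by omega) e11
    have n12 := ne_zero_of_pow_eq hn0 (by omega) e12
    have n21 := ne_zero_of_pow_eq hn0 (by omega) e21
    have n22 := ne_zero_of_pow_eq hn0 (by omega) e22
    have hu : ((X i.2 j.1 * X i.1 j.2 : ℕ) : ℤ) ^ n = (i.2 + j.1) * (i.1 + j.2) := by
      push_cast
      rw [mul_pow, e21, e12]
    have hv : ((X i.1 j.1 * X i.2 j.2 : ℕ) : ℤ) ^ n = (i.1 + j.1) * (i.2 + j.2) := by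
      push_cast
      rw [mul_pow, e11, e22]
    have hD : ((X i.2 j.1 * X i.1 j.2 : ℕ) : ℤ) ^ n - ((X i.1 j.1 * X i.2 j.2 : ℕ) : ℤ) ^ n =
        (i.2 - i.1) * (j.2 - j.1) := by
      rw [hu, hv]
      ring
    have b1 := two_mul_abs_mul_le (a := i.1) (a' := i.2) (b := j.1) (b' := j.2)
      (by omega) (by omega) (by omega) (by omega) q1 (by rw [abs_sub_comm]; exact q2)
    have b2 := two_mul_abs_mul_le (a := i.2) (a' := i.1) (b := j.1) (b' := j.2)
      (by omega) (by omega) (by omega) (by omega) q2 (by rw [abs_sub_comm]; exact q1)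
    rw [← hu] at b1
    rw [abs_mul, abs_sub_comm, ← abs_mul, ← hv] at b2
    refine log_sub_add_log_le (mul_ne_zero n21 n12) (mul_ne_zero n11 n22) ?_ hn0
      (by exact_mod_cast hD) (by exact_mod_cast b1) (by exact_mod_cast b2)
    intro h
    rw [h, sub_self] at hD
    exact mul_ne_zero (sub_ne_zero.2 hine.symm) (sub_ne_zero.2 hjne.symm) hD.symm
  simp only [Finset.sum_sub_distrib, Finset.sum_const, nsmul_eq_mul, ← Finset.sum_mul] at h2
  rw [← Nat.cast_sum] at h2
  set S : ℝ := ((∑ i ∈ A.offDiag, (commonNeighbors X n B i).offDiag.card : ℕ) : ℝ) with hS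
  set T : ℝ := A.card * B.card * (A.card + B.card) * Real.log N with hT
  have h3 : S * ((n - 1) * Real.log 2) ≤ n * T := by linarith
  have hT0 : 0 ≤ T := mul_nonneg (by positivity) (Real.log_natCast_nonneg N)
  have hn2 : (2 : ℝ) ≤ n := by exact_mod_cast hn
  have h4 : (n - 1 : ℝ) * (S * Real.log 2) ≤ (n - 1) * (2 * T) := by nlinarith
  exact le_of_mul_le_mul_left h4 (by linarith)

/-- The set of pairs of `A × B` whose sum is the `n`-th power of the chosen base. -/
def powerEdges (X : ℤ → ℤ → ℕ) (n : ℕ) (A B : Finset ℤ) : Finset (ℤ × ℤ) :=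
  (A ×ˢ B).filter fun p => (X p.1 p.2 : ℤ) ^ n = p.1 + p.2

lemma card_powerEdges_pow_four_le (X : ℤ → ℤ → ℕ) (n : ℕ) (A B : Finset ℤ) :
    (powerEdges X n A B).card ^ 4 ≤
      (A.card * B.card) ^ 2 * ∑ i ∈ A ×ˢ A, (commonNeighbors X n B i).card ^ 2 := by
  classical
  have hdeg : (powerEdges X n A B).card =
      ∑ b ∈ B, (A.filter fun a => (X a b : ℤ) ^ n = a + b).card := by
    rw [powerEdges, Finset.card_filter, Finset.sum_product_right]
    simp only [Finset.card_filter]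
  have hcherry : ∑ b ∈ B, (A.filter fun a => (X a b : ℤ) ^ n = a + b).card ^ 2 =
      ∑ i ∈ A ×ˢ A, (commonNeighbors X n B i).card := by
    simp only [commonNeighbors, Finset.card_filter]
    rw [Finset.sum_comm]
    refine Finset.sum_congr rfl fun b _ => ?_
    rw [sq, Finset.sum_mul_sum, ← Finset.sum_product']
    refine Finset.sum_congr rfl fun i _ => ?_
    split_ifs <;> simp_all
  have h1 : (powerEdges X n A B).card ^ 2 ≤
      B.card * ∑ i ∈ A ×ˢ A, (commonNeighbors X n B i).card := by
    rw [hdeg, ← hcherry]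
    exact sq_sum_le_card_mul_sum_sq
  have h2 : (∑ i ∈ A ×ˢ A, (commonNeighbors X n B i).card) ^ 2 ≤
      (A ×ˢ A).card * ∑ i ∈ A ×ˢ A, (commonNeighbors X n B i).card ^ 2 :=
    sq_sum_le_card_mul_sum_sq
  rw [Finset.card_product] at h2
  calc (powerEdges X n A B).card ^ 4 = ((powerEdges X n A B).card ^ 2) ^ 2 := by ring
    _ ≤ (B.card * ∑ i ∈ A ×ˢ A, (commonNeighbors X n B i).card) ^ 2 := Nat.pow_le_pow_left h1 2
    _ = B.card ^ 2 * (∑ i ∈ A ×ˢ A, (commonNeighbors X n B i).card) ^ 2 := by ring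
    _ ≤ B.card ^ 2 * (A.card * A.card *
        ∑ i ∈ A ×ˢ A, (commonNeighbors X n B i).card ^ 2) := Nat.mul_le_mul_left _ h2
    _ = _ := by ring

lemma sum_sq_card_commonNeighbors_le (X : ℤ → ℤ → ℕ) (n : ℕ) (A B : Finset ℤ) :
    ∑ i ∈ A ×ˢ A, (commonNeighbors X n B i).card ^ 2 ≤
      ∑ i ∈ A.offDiag, (commonNeighbors X n B i).offDiag.card +
        A.card * B.card * (A.card + B.card) := by
  have hle : ∀ i, (commonNeighbors X n B i).card ≤ B.card := fun i =>
    Finset.card_le_card (Finset.filter_subset _ _)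
  have hsq : ∀ i, (commonNeighbors X n B i).card ^ 2 ≤
      (commonNeighbors X n B i).offDiag.card + B.card := by
    intro i
    have := hle i
    rw [Finset.offDiag_card, sq]
    omega
  rw [← Finset.diag_union_offDiag, Finset.sum_union (Finset.disjoint_diag_offDiag A)]
  have h1 : ∑ i ∈ A.diag, (commonNeighbors X n B i).card ^ 2 ≤ A.card * B.card ^ 2 := by
    rw [← Finset.diag_card A, ← smul_eq_mul, ← Finset.sum_const]
    exact Finset.sum_le_sum fun i _ => Nat.pow_le_pow_left (hle i) 2
  have h2 : ∑ i ∈ A.offDiag, (commonNeighbors X n B i).card ^ 2 ≤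
      ∑ i ∈ A.offDiag, (commonNeighbors X n B i).offDiag.card + A.card ^ 2 * B.card := by
    refine (Finset.sum_le_sum fun i _ => hsq i).trans ?_
    rw [Finset.sum_add_distrib, Finset.sum_const, smul_eq_mul, Finset.offDiag_card, sq]
    exact Nat.add_le_add_left (Nat.mul_le_mul_right _ (Nat.sub_le _ _)) _
  calc _ ≤ _ := add_le_add h1 h2
    _ = _ := by ring

lemma card_mul_card_le {n : ℕ} (hn : 2 ≤ n) (X : ℤ → ℤ → ℕ) {A B : Finset ℤ} {N : ℕ}
    (hA : ∀ a ∈ A, 1 ≤ a ∧ a ≤ (N : ℤ)) (hB : ∀ b ∈ B, 1 ≤ b ∧ b ≤ (N : ℤ))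
    (hAA : ∀ a ∈ A, ∀ a' ∈ A, 2 * |a' - a| ≤ a) (hN : 1 ≤ Real.log N) {l : ℕ}
    (hl : A.card * B.card ≤ l * (powerEdges X n A B).card) :
    (A.card * B.card : ℝ) ≤ 4 * l ^ 4 * Real.log N * (A.card + B.card) := by
  rcases Nat.eq_zero_or_pos (A.card * B.card) with h0 | h0
  · have h0' : (A.card * B.card : ℝ) = 0 := by exact_mod_cast h0
    rw [h0']
    positivity
  have hc := card_cycles_le hn X hA hB hAA
  have h1 := card_powerEdges_pow_four_le X n A B
  have h2 := sum_sq_card_commonNeighbors_le X n A B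
  set S := ∑ i ∈ A.offDiag, (commonNeighbors X n B i).offDiag.card
  set e := (powerEdges X n A B).card
  have h3 : (A.card * B.card) ^ 4 ≤
      l ^ 4 * ((A.card * B.card) ^ 2 * (S + A.card * B.card * (A.card + B.card))) :=
    calc _ ≤ (l * e) ^ 4 := Nat.pow_le_pow_left hl 4
      _ = l ^ 4 * e ^ 4 := by ring
      _ ≤ _ := Nat.mul_le_mul_left _ (h1.trans (Nat.mul_le_mul_left _ h2))
  have h4 : (A.card * B.card) ^ 2 ≤
      l ^ 4 * (S + A.card * B.card * (A.card + B.card)) := by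
    refine le_of_mul_le_mul_left (a := (A.card * B.card) ^ 2) ?_ (by positivity)
    calc _ = (A.card * B.card) ^ 4 := by ring
      _ ≤ _ := h3
      _ = _ := by ring
  have h4' : ((A.card : ℝ) * B.card) ^ 2 ≤
      l ^ 4 * (S + A.card * B.card * (A.card + B.card)) := by exact_mod_cast h4
  have hpos : (0 : ℝ) < A.card * B.card := by exact_mod_cast h0
  set P : ℝ := A.card * B.card
  set s : ℝ := A.card + B.card
  have hs : 0 ≤ s := by positivity
  have hPs : 0 ≤ P * s := by positivity
  have hS : (S : ℝ) + P * s ≤ 4 * (P * s * Real.log N) := by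
    have hlog2 := Real.log_two_gt_d9
    have hS0 : (0 : ℝ) ≤ S := Nat.cast_nonneg S
    have : P * s ≤ P * s * Real.log N := le_mul_of_one_le_right hPs hN
    nlinarith
  refine le_of_mul_le_mul_left (a := P) ?_ hpos
  calc P * P = P ^ 2 := by ring
    _ ≤ l ^ 4 * (S + P * s) := h4'
    _ ≤ l ^ 4 * (4 * (P * s * Real.log N)) := mul_le_mul_of_nonneg_left hS (by positivity)
    _ = _ := by ring

lemma min_card_le {A B : Finset ℤ} {N : ℕ}
    (hA : ∀ a ∈ A, 1 ≤ a ∧ a ≤ (N : ℤ)) (hB : ∀ b ∈ B, 1 ≤ b ∧ b ≤ (N : ℤ))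
    (hAA : ∀ a ∈ A, ∀ a' ∈ A, 2 * |a' - a| ≤ a) (hN : 1 ≤ Real.log N)
    (hAB : ∀ a ∈ A, ∀ b ∈ B, ∃ x n : ℕ, 2 ≤ n ∧ a + b = (x : ℤ) ^ n) :
    (min A.card B.card : ℝ) ≤ 8 * (Nat.log 2 (2 * N)) ^ 4 * Real.log N := by
  classical
  set l := Nat.log 2 (2 * N)
  choose! X f hf hX using hAB
  have hmaps : ∀ p ∈ A ×ˢ B, f p.1 p.2 ∈ Finset.Icc 2 l := by
    intro p hp
    rw [Finset.mem_product] at hp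
    have h1 := hA _ hp.1
    have h2 := hB _ hp.2
    have hx := hX _ hp.1 _ hp.2
    have hn := hf _ hp.1 _ hp.2
    refine Finset.mem_Icc.2 ⟨hn, Nat.le_log_of_pow_le one_lt_two ?_⟩
    have hx2 : 2 ≤ X p.1 p.2 := by
      by_contra! h
      have : X p.1 p.2 ^ f p.1 p.2 ≤ 1 := pow_le_one₀ (Nat.zero_le _) (by omega)
      have : ((X p.1 p.2 : ℕ) : ℤ) ^ f p.1 p.2 ≤ 1 := by exact_mod_cast this
      omega
    have h3 : X p.1 p.2 ^ f p.1 p.2 ≤ 2 * N := by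
      have : ((X p.1 p.2 : ℕ) : ℤ) ^ f p.1 p.2 ≤ 2 * N := by omega
      exact_mod_cast this
    exact (Nat.pow_le_pow_left hx2 _).trans h3
  rcases (A ×ˢ B).eq_empty_or_nonempty with h0 | ⟨p, hp⟩
  · have : min A.card B.card = 0 := by
      rcases Finset.product_eq_empty.1 h0 with h | h <;> simp [h]
    have h' : (min A.card B.card : ℝ) = 0 := by exact_mod_cast this
    rw [h']
    positivity
  have hl2 : 2 ≤ l := (Finset.mem_Icc.1 (hmaps p hp)).1.trans (Finset.mem_Icc.1 (hmaps p hp)).2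
  obtain ⟨n, hn, hcard⟩ : ∃ n ∈ Finset.Icc 2 l,
      (A ×ˢ B).card ≤ l * ((A ×ˢ B).filter fun p => f p.1 p.2 = n).card := by
    by_contra! h
    have h1 := Finset.card_eq_sum_card_fiberwise hmaps
    have h2 : ∑ n ∈ Finset.Icc 2 l, l * ((A ×ˢ B).filter fun p => f p.1 p.2 = n).card <
        ∑ n ∈ Finset.Icc 2 l, (A ×ˢ B).card :=
      Finset.sum_lt_sum_of_nonempty ⟨2, Finset.mem_Icc.2 ⟨le_rfl, hl2⟩⟩ h
    rw [← Finset.mul_sum, ← h1, Finset.sum_const, smul_eq_mul, Nat.card_Icc] at h2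
    have h3 : (l + 1 - 2) * (A ×ˢ B).card ≤ l * (A ×ˢ B).card :=
      Nat.mul_le_mul_right _ (by omega)
    omega
  have hsub : (A ×ˢ B).filter (fun p => f p.1 p.2 = n) ⊆ powerEdges X n A B := by
    intro p hp
    rw [Finset.mem_filter] at hp
    rw [powerEdges, Finset.mem_filter, Finset.mem_product] at *
    refine ⟨hp.1, ?_⟩
    rw [hX _ hp.1.1 _ hp.1.2, hp.2]
  have h := card_mul_card_le (Finset.mem_Icc.1 hn).1 X hA hB hAA hN (l := l) (by
    rw [← Finset.card_product]
    exact hcard.trans (Nat.mul_le_mul_left _ (Finset.card_le_card hsub)))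
  have hpA : (0 : ℝ) < A.card := by
    exact_mod_cast Finset.card_pos.2 ⟨_, (Finset.mem_product.1 hp).1⟩
  have hpB : (0 : ℝ) < B.card := by
    exact_mod_cast Finset.card_pos.2 ⟨_, (Finset.mem_product.1 hp).2⟩
  set K : ℝ := (l : ℝ) ^ 4 * Real.log N
  have hK : 0 ≤ K := by positivity
  rw [show 8 * (l : ℝ) ^ 4 * Real.log N = 8 * K by ring]
  rw [show 4 * (l : ℝ) ^ 4 * Real.log N = 4 * K by ring] at h
  rcases le_total (A.card : ℝ) B.card with hle | hle
  · rw [min_eq_left hle]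
    refine le_of_mul_le_mul_right (a := (B.card : ℝ)) (h.trans ?_) hpB
    nlinarith
  · rw [min_eq_right hle]
    refine le_of_mul_le_mul_left (a := (A.card : ℝ)) (h.trans ?_) hpA
    nlinarith

/-- A set of positive integers up to `N` has a large subset contained in a short multiplicative
interval. -/
lemma exists_narrow_subset {A : Finset ℤ} {N : ℕ} (hA : ∀ a ∈ A, 1 ≤ a ∧ a ≤ (N : ℤ)) :
    ∃ A' ⊆ A, A.card ≤ (2 * Nat.log 2 (2 * N) + 2) * A'.card ∧
      ∀ a ∈ A', ∀ a' ∈ A', 2 * |a' - a| ≤ a := by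
  classical
  set l := Nat.log 2 (2 * N)
  set g : ℤ → ℕ := fun a => Nat.log 2 (a.toNat ^ 2)
  have hmaps : ∀ a ∈ A, g a ∈ Finset.range (2 * l + 2) := by
    intro a ha
    have := hA a ha
    rw [Finset.mem_range]
    refine Nat.log_lt_of_lt_pow (pow_ne_zero 2 (by omega)) ?_
    calc a.toNat ^ 2 ≤ (2 * N) ^ 2 := Nat.pow_le_pow_left (by omega) 2
      _ < (2 ^ (l + 1)) ^ 2 :=
        Nat.pow_lt_pow_left (Nat.lt_pow_succ_log_self one_lt_two _) two_ne_zero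
      _ = 2 ^ (2 * l + 2) := by rw [← pow_mul]; congr 1; ring
  obtain ⟨k, hk, hcard⟩ : ∃ k ∈ Finset.range (2 * l + 2),
      A.card ≤ (2 * l + 2) * (A.filter fun a => g a = k).card := by
    by_contra! h
    have h1 := Finset.card_eq_sum_card_fiberwise hmaps
    have h2 := Finset.sum_lt_sum_of_nonempty ⟨0, Finset.mem_range.2 (by omega)⟩ h
    rw [← Finset.mul_sum, ← h1, Finset.sum_const, smul_eq_mul, Finset.card_range] at h2
    exact lt_irrefl _ h2
  refine ⟨_, Finset.filter_subset _ _, hcard, ?_⟩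
  have hlt : ∀ a ∈ A.filter (fun a => g a = k), ∀ a' ∈ A.filter (fun a => g a = k),
      a' ^ 2 < 2 * a ^ 2 := by
    intro a ha a' ha'
    rw [Finset.mem_filter] at ha ha'
    have h1 := (hA a ha.1).1
    have h2 := (hA a' ha'.1).1
    have h3 : a'.toNat ^ 2 < 2 ^ (k + 1) := by
      rw [← ha'.2]
      exact Nat.lt_pow_succ_log_self one_lt_two _
    have h4 : 2 ^ k ≤ a.toNat ^ 2 := by
      rw [← ha.2]
      exact Nat.pow_log_le_self 2 (pow_ne_zero 2 (by omega))
    have h5 : a'.toNat ^ 2 < 2 * a.toNat ^ 2 := by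
      rw [pow_succ 2 k] at h3
      omega
    zify at h5
    rwa [Int.toNat_of_nonneg (by omega), Int.toNat_of_nonneg (by omega)] at h5
  intro a ha a' ha'
  have h1 := hlt a ha a' ha'
  have h2 := hlt a' ha' a ha
  have p1 := (hA a (Finset.mem_filter.1 ha).1).1
  have p2 := (hA a' (Finset.mem_filter.1 ha').1).1
  have : 2 * a' ≤ 3 * a := by nlinarith
  have : a ≤ 2 * a' := by nlinarith
  rcases abs_cases (a' - a) with h | h <;> omega

lemma natLog_two_mul_le {N : ℕ} (hN : 1 ≤ Real.log N) :
    (Nat.log 2 (2 * N) : ℝ) ≤ 3 * Real.log N := by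
  have hN0 : N ≠ 0 := by
    rintro rfl
    norm_num at hN
  have h : ((2 : ℝ)) ^ Nat.log 2 (2 * N) ≤ 2 * N := by
    exact_mod_cast Nat.pow_log_le_self 2 (by omega : 2 * N ≠ 0)
  have h1 := Real.log_le_log (by positivity) h
  rw [Real.log_pow, Real.log_mul two_ne_zero (by exact_mod_cast hN0)] at h1
  have h2 := Real.log_two_gt_d9
  have h3 := Real.log_two_lt_d9
  nlinarith [Nat.cast_nonneg (α := ℝ) (Nat.log 2 (2 * N))]

lemma min_card_le_log_pow {A B : Finset ℤ} {N : ℕ} (hN : 3 ≤ N)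
    (hA : ∀ a ∈ A, 1 ≤ a ∧ a ≤ (N : ℤ)) (hB : ∀ b ∈ B, 1 ≤ b ∧ b ≤ (N : ℤ))
    (hAB : ∀ a ∈ A, ∀ b ∈ B, ∃ x n : ℕ, 2 ≤ n ∧ a + b = (x : ℤ) ^ n) :
    (min A.card B.card : ℝ) ≤ 5184 * Real.log N ^ 6 := by
  have hlog : 1 ≤ Real.log N := by
    rw [Real.le_log_iff_exp_le (by positivity)]
    have : (3 : ℝ) ≤ N := by exact_mod_cast hN
    linarith [Real.exp_one_lt_d9]
  obtain ⟨A', hsub, hcard, hnarrow⟩ := exists_narrow_subset hA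
  have h := min_card_le (fun a ha => hA a (hsub ha)) hB hnarrow hlog
    fun a ha => hAB a (hsub ha)
  have hl := natLog_two_mul_le hlog
  set l := Nat.log 2 (2 * N)
  set L := Real.log N
  have hcard' : (A.card : ℝ) ≤ (2 * l + 2) * A'.card := by exact_mod_cast hcard
  have h2l : (2 * l + 2 : ℝ) ≤ 8 * L := by linarith
  have hmin : (min A.card B.card : ℝ) ≤ (2 * l + 2) * min (A'.card : ℝ) B.card := by
    rw [mul_min_of_nonneg _ _ (by positivity)]
    refine min_le_min hcard' (le_mul_of_one_le_left (Nat.cast_nonneg _) ?_)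
    linarith [Nat.cast_nonneg (α := ℝ) l]
  calc (min A.card B.card : ℝ) ≤ (2 * l + 2) * (8 * l ^ 4 * L) :=
        hmin.trans (mul_le_mul_of_nonneg_left h (by positivity))
    _ ≤ 8 * L * (8 * (3 * L) ^ 4 * L) := by gcongr
    _ = 5184 * L ^ 6 := by ring

/-- Sums of five sets in the pure powers: if `A i + A j ⊆ V` for all `i ≠ j`
with `Aᵢ ⊆ [1, N]`, then `min |Aᵢ| ≤ C (log N)^M`. -/
theorem stmt_15 :
    ∃ M C : ℝ, 0 < M ∧ 0 < C ∧ ∀ N : ℕ, 3 ≤ N →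
      ∀ A : Fin 5 → Finset ℤ,
        (∀ i, (A i).Nonempty) →
        (∀ i, ∀ x ∈ A i, 1 ≤ x ∧ x ≤ (N : ℤ)) →
        (∀ i j, i ≠ j → ∀ x ∈ A i, ∀ y ∈ A j,
          ∃ a n : ℕ, 1 ≤ a ∧ 2 ≤ n ∧ x + y = (a : ℤ) ^ n) →
        ∃ i, ((A i).card : ℝ) ≤ C * (Real.log N) ^ M := by
  refine ⟨6, 5184, by norm_num, by norm_num, fun N hN A _ hA hAA => ?_⟩
  have h := min_card_le_log_pow hN (hA 0) (hA 1) fun a ha b hb =>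
    let ⟨x, n, _, hn, hx⟩ := hAA 0 1 (by decide) a ha b hb
    ⟨x, n, hn, hx⟩
  rw [← Real.rpow_ofNat] at h
  rcases min_le_iff.1 h with h | h
  · exact ⟨0, h⟩
  · exact ⟨1, h⟩
end

section
/- For a positive integer N, let ℓ(N) be the largest positive integer ℓ for which there exists a positive integer x such that x, 2x, 3x, …, ℓx are all pure powers not exceeding N. Then there exist positive constants c₁, c₂ and N₀ such that for all N ≥ N₀: c₁ · log log N / log log log N ≤ ℓ(N) ≤ c₂ · log log N / log log log N. -/
/-- A pure power is a positive integer of the form `a ^ n` with `a ≥ 1`, `n ≥ 2`. -/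
def IsPurePower (m : ℕ) : Prop := ∃ a n : ℕ, 1 ≤ a ∧ 2 ≤ n ∧ m = a ^ n

open Finset Filter

/-- Among `1, …, n` at least a quarter of the numbers are squarefree. -/
lemma le_four_mul_card_squarefree (n : ℕ) :
    (n : ℝ) ≤ 4 * ((Icc 1 n).filter Squarefree).card := by
  have hcov : (Icc 1 n).filter (fun m => ¬ Squarefree m) ⊆
      (Icc 2 (n + 2)).biUnion fun d => (Ioc 0 n).filter (d ^ 2 ∣ ·) := by
    intro m hm
    simp only [mem_filter, mem_Icc] at hm
    obtain ⟨⟨h1, h2⟩, h3⟩ := hm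
    rw [Nat.squarefree_iff_prime_squarefree] at h3
    push Not at h3
    obtain ⟨p, hp, hd⟩ := h3
    have := Nat.le_of_dvd h1 hd
    simp only [mem_biUnion, mem_Icc, mem_filter, mem_Ioc]
    exact ⟨p, ⟨hp.two_le, by nlinarith [hp.two_le]⟩, ⟨h1, h2⟩, by rwa [sq]⟩
  have hcard : (((Icc 1 n).filter (fun m => ¬ Squarefree m)).card : ℝ) ≤ n * (3 / 4) := by
    calc (((Icc 1 n).filter (fun m => ¬ Squarefree m)).card : ℝ)
        ≤ ∑ d ∈ Icc 2 (n + 2), (((Ioc 0 n).filter (d ^ 2 ∣ ·)).card : ℝ) := by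
          exact_mod_cast (card_le_card hcov).trans card_biUnion_le
      _ ≤ ∑ d ∈ Icc 2 (n + 2), (n : ℝ) * ((d : ℝ) ^ 2)⁻¹ := by
          refine sum_le_sum fun d _ => ?_
          rw [Nat.Ioc_filter_dvd_card_eq_div, ← div_eq_mul_inv]
          exact_mod_cast Nat.cast_div_le (α := ℝ)
      _ = n * ∑ d ∈ Icc 2 (n + 2), ((d : ℝ) ^ 2)⁻¹ := by rw [mul_sum]
      _ ≤ n * (3 / 4) := by
          gcongr
          have h := sum_Ioc_inv_sq_le_sub (α := ℝ) (k := 2) (n := n + 2) two_ne_zero (by omega)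
          have h0 : (0 : ℝ) ≤ ((n : ℝ) + 2)⁻¹ := by positivity
          rw [← insert_Icc_add_one_left_eq_Icc (by omega : 2 ≤ n + 2), sum_insert (by simp)]
          have : Icc (2 + 1) (n + 2) = Ioc 2 (n + 2) := by ext; simp; omega
          rw [this]
          norm_num at h ⊢
          linarith
  have hsum := card_filter_add_card_filter_not (s := Icc 1 n) Squarefree
  have hsum' : (((Icc 1 n).filter Squarefree).card : ℝ) +
      ((Icc 1 n).filter (fun m => ¬ Squarefree m)).card = n := by
    exact_mod_cast hsum.trans (by simp)
  linarith

/-- A product of distinct positive integers is at least the factorial of their number. -/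
lemma factorial_card_le_prod (s : Finset ℕ) (hs : ∀ m ∈ s, 0 < m) :
    s.card.factorial ≤ ∏ m ∈ s, m := by
  induction s using Finset.induction_on_max with
  | empty => simp
  | insert a s ha ih =>
    have hna : a ∉ s := fun h => (ha a h).false
    rw [card_insert_of_notMem hna, prod_insert hna, Nat.factorial_succ]
    refine Nat.mul_le_mul ?_ (ih fun m hm => hs m (mem_insert_of_mem hm))
    have hsub : insert a s ⊆ Icc 1 a := by
      intro m hm
      refine mem_Icc.2 ⟨hs m hm, ?_⟩
      rcases mem_insert.1 hm with rfl | h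
      exacts [le_rfl, (ha m h).le]
    simpa [card_insert_of_notMem hna] using card_le_card hsub

lemma IsPurePower.exists_prime_dvd_factorization {m : ℕ} (h : IsPurePower m) :
    ∃ p : ℕ, p.Prime ∧ ∀ q, p ∣ m.factorization q := by
  obtain ⟨a, n, -, hn, rfl⟩ := h
  refine ⟨n.minFac, Nat.minFac_prime (by omega), fun q => ?_⟩
  rw [Nat.factorization_pow]
  exact (Nat.minFac_dvd n).trans (by simp)

lemma exists_factorization_succ_eq_of_squarefree {i j : ℕ} (hi : Squarefree i) (hj : Squarefree j)
    (hij : i ≠ j) : ∃ q : ℕ, i.factorization q + 1 = j.factorization q ∨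
      j.factorization q + 1 = i.factorization q := by
  by_contra! h
  refine hij (Nat.eq_of_factorization_eq hi.ne_zero hj.ne_zero fun q => ?_)
  have h1 := hi.natFactorization_le_one q
  have h2 := hj.natFactorization_le_one q
  have := h q
  omega

/-- If `x, 2x, …, ℓx` are pure powers, then the `2`-adic valuation of `x` is large. -/
lemma factorial_card_squarefree_le {ℓ x : ℕ} (hℓ : 2 ≤ ℓ) (hx : 0 < x)
    (h : ∀ j : ℕ, 1 ≤ j → j ≤ ℓ → IsPurePower (j * x)) :
    ((Icc 1 ℓ).filter Squarefree).card.factorial ≤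
      x.factorization 2 * (x.factorization 2 + 1) := by
  set S := (Icc 1 ℓ).filter Squarefree with hS
  set v := x.factorization 2
  have hex : ∀ j : ℕ, ∃ p : ℕ, j ∈ Icc 1 ℓ →
      p.Prime ∧ ∀ q, p ∣ j.factorization q + x.factorization q := by
    intro j
    by_cases hj : j ∈ Icc 1 ℓ
    · obtain ⟨p, hp, hd⟩ := (h j (mem_Icc.1 hj).1 (mem_Icc.1 hj).2).exists_prime_dvd_factorization
      refine ⟨p, fun _ => ⟨hp, fun q => ?_⟩⟩
      have hj1 := (mem_Icc.1 hj).1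
      have := hd q
      rwa [Nat.factorization_mul (by omega) (by omega), Finsupp.add_apply] at this
    · exact ⟨0, fun h => absurd h hj⟩
  choose p hp using hex
  have hSI : ∀ j ∈ S, j ∈ Icc 1 ℓ := fun j hj => (mem_filter.1 hj).1
  have hsucc : ∀ i ∈ S, ∀ j ∈ S, ∀ q, i.factorization q + 1 = j.factorization q → p i ≠ p j := by
    intro i hi j hj q hq he
    have h1 := (hp i (hSI i hi)).2 q
    have h2 := (hp j (hSI j hj)).2 q
    rw [← he, ← hq, add_right_comm] at h2
    exact (hp i (hSI i hi)).1.one_lt.ne' (Nat.dvd_one.1 ((Nat.dvd_add_right h1).1 h2))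
  have hinj : Set.InjOn p S := by
    intro i hi j hj he
    by_contra hne
    obtain ⟨q, hq | hq⟩ := exists_factorization_succ_eq_of_squarefree (mem_filter.1 hi).2
      (mem_filter.1 hj).2 hne
    · exact hsucc i hi j hj q hq he
    · exact hsucc j hj i hi q hq he.symm
  have hv : 0 < v := by
    have h1 := hp 1 (mem_Icc.2 ⟨le_rfl, by omega⟩)
    have h2 := hp 2 (mem_Icc.2 ⟨by omega, hℓ⟩)
    have h3 := h2.2 2
    rw [Nat.prime_two.factorization_self] at h3
    by_contra hv
    have : x.factorization 2 = 0 := by omega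
    rw [this] at h3
    exact h2.1.one_lt.ne' (Nat.dvd_one.1 h3)
  rw [← card_image_of_injOn hinj]
  refine (factorial_card_le_prod _ ?_).trans (Nat.le_of_dvd (by positivity) ?_)
  · intro m hm
    obtain ⟨j, hj, rfl⟩ := mem_image.1 hm
    exact (hp j (hSI j hj)).1.pos
  · refine prod_primes_dvd _ ?_ ?_
    · intro m hm
      obtain ⟨j, hj, rfl⟩ := mem_image.1 hm
      exact (hp j (hSI j hj)).1.prime
    · intro m hm
      obtain ⟨j, hj, rfl⟩ := mem_image.1 hm
      have h2 := (hp j (hSI j hj)).2 2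
      have h3 := (mem_filter.1 hj).2.natFactorization_le_one 2
      obtain h0 | h1 : j.factorization 2 = 0 ∨ j.factorization 2 = 1 := by omega
      · rw [h0, zero_add] at h2
        exact h2.mul_right _
      · rw [h1, add_comm] at h2
        exact h2.mul_left _

lemma log_le_two_mul_sqrt {y : ℝ} (hy : 0 < y) : Real.log y ≤ 2 * √y := by
  have h := Real.log_le_self (Real.sqrt_nonneg y)
  rw [Real.log_sqrt hy.le] at h
  linarith

lemma length_le {N ℓ x : ℕ} (hN : 3 ≤ Real.log (Real.log N)) (hx : 0 < x)
    (h : ∀ j : ℕ, 1 ≤ j → j ≤ ℓ → IsPurePower (j * x) ∧ j * x ≤ N) :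
    (ℓ : ℝ) ≤ 64 * Real.log (Real.log N) / Real.log (Real.log (Real.log N)) := by
  set L := Real.log N with hL
  set y := Real.log L with hy
  by_contra! hlt
  have hlogy : 0 < Real.log y := Real.log_pos (by linarith)
  have hsq : 0 < √y := Real.sqrt_pos.2 (by linarith)
  have hsy : √y * √y = y := Real.mul_self_sqrt (by linarith)
  have hL0 : 0 < L := by
    have : 0 ≤ L := Real.log_natCast_nonneg N
    rcases this.eq_or_lt with h0 | h0
    · rw [hy, ← h0, Real.log_zero] at hN
      norm_num at hN
    · exact h0
  have h32 : 32 * √y ≤ 64 * y / Real.log y := by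
    rw [le_div_iff₀ hlogy]
    nlinarith [log_le_two_mul_sqrt (by linarith : 0 < y)]
  have hs1 : 1 ≤ √y := Real.one_le_sqrt.2 (by linarith)
  have hℓ : 2 ≤ ℓ := by
    have : (2 : ℝ) ≤ ℓ := by linarith
    exact_mod_cast this
  have hk4 := le_four_mul_card_squarefree ℓ
  have hfac := factorial_card_squarefree_le hℓ hx fun j h1 h2 => (h j h1 h2).1
  set k := ((Icc 1 ℓ).filter Squarefree).card
  set v := x.factorization 2
  have hxN : x ≤ N := by simpa using (h 1 le_rfl (by omega)).2
  have hvL : (v : ℝ) ≤ 2 * L := by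
    have h2v : 2 ^ v ≤ N := (Nat.le_of_dvd hx (Nat.ordProj_dvd x 2)).trans hxN
    have : Real.log ((2 : ℝ) ^ v) ≤ L :=
      Real.log_le_log (by positivity) (by exact_mod_cast h2v)
    rw [Real.log_pow] at this
    nlinarith [Real.log_two_gt_d9, (Nat.cast_nonneg v : (0 : ℝ) ≤ v)]
  have hv1 : v ≠ 0 := by
    intro h0
    rw [h0] at hfac
    have := Nat.factorial_pos k
    omega
  have hfacL : (k.factorial : ℝ) ≤ 8 * L ^ 2 := by
    have h1 : (k.factorial : ℝ) ≤ v * (v + 1) := by exact_mod_cast hfac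
    have h2 : (1 : ℝ) ≤ v := by exact_mod_cast Nat.one_le_iff_ne_zero.2 hv1
    nlinarith
  have hk : 16 * y / Real.log y ≤ k := by
    have : 16 * y / Real.log y = (64 * y / Real.log y) / 4 := by ring
    rw [this]
    linarith
  have hkpos : (0 : ℝ) < k := by nlinarith
  have hlogk : 1 + Real.log y / 2 ≤ Real.log k := by
    have : Real.exp 1 * √y ≤ k := by nlinarith [Real.exp_one_lt_d9]
    have := Real.log_le_log (by positivity) this
    rwa [Real.log_mul (Real.exp_ne_zero 1) hsq.ne', Real.log_exp,
      Real.log_sqrt (by linarith)] at this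
  have hupper : k * Real.log k - k ≤ 3 * y := by
    have h1 := Real.pow_div_factorial_le_exp (k : ℝ) hkpos.le k
    rw [div_le_iff₀ (by positivity)] at h1
    have h2 : (k : ℝ) ^ k ≤ Real.exp k * (8 * L ^ 2) := h1.trans (by gcongr)
    have h3 := Real.log_le_log (by positivity) h2
    rw [Real.log_pow, Real.log_mul (Real.exp_ne_zero _) (by positivity), Real.log_exp,
      Real.log_mul (by norm_num) (by positivity), Real.log_pow] at h3
    have h8 : Real.log 8 ≤ 3 := by
      rw [show (8 : ℝ) = 2 ^ 3 by norm_num, Real.log_pow]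
      push_cast
      linarith [Real.log_two_lt_d9]
    push_cast at h3
    linarith
  have h8y : 8 * y ≤ k * (Real.log y / 2) := by
    rw [div_le_iff₀ hlogy] at hk
    linarith
  nlinarith

lemma eventually_lt_primeCounting_sq : ∀ᶠ n : ℕ in atTop, n < Nat.primeCounting (n ^ 2) := by
  have hlog : ∀ᶠ n : ℕ in atTop, Real.log n ≤ n / 20 := by
    have := tendsto_natCast_atTop_atTop.eventually
      (Real.isLittleO_log_id_atTop.bound (by norm_num : (0 : ℝ) < 1 / 20))
    filter_upwards [this] with n hn
    simp only [Real.norm_eq_abs, id, Nat.abs_cast] at hn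
    linarith [le_abs_self (Real.log n)]
  filter_upwards [hlog, eventually_ge_atTop 2] with n hn h2
  have h2' : (2 : ℝ) ≤ n := by exact_mod_cast h2
  have hlogn : 0 < Real.log n := Real.log_pos (by linarith)
  have hπ := Chebyshev.pi_ge (n ^ 2)
  push_cast at hπ
  rw [Real.log_pow] at hπ
  have h3 : Real.log ((n : ℝ) ^ 2 + 1) ≤ 3 * Real.log n := by
    have := Real.log_le_log (by positivity) (by nlinarith : (n : ℝ) ^ 2 + 1 ≤ (n : ℝ) ^ 3)
    simpa [Real.log_pow] using this
  have : (n : ℝ) < Nat.primeCounting (n ^ 2) := by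
    refine lt_of_lt_of_le ?_ hπ
    rw [lt_div_iff₀ (by push_cast; positivity)]
    push_cast
    nlinarith [Real.log_two_gt_d9]
  exact_mod_cast this

/-- A product of powers `1 ^ e₁ ⋯ ℓ ^ e_ℓ` whose first `ℓ` multiples are perfect powers with
prescribed pairwise coprime exponents. -/
lemma exists_forall_mul_eq_pow (ℓ : ℕ) (p : ℕ → ℕ) (hpos : ∀ i, 0 < p i)
    (hp : Pairwise (Function.onFun Nat.Coprime p)) :
    ∃ x : ℕ, 0 < x ∧ x ≤ ℓ ^ (ℓ * ∏ i ∈ Icc 1 ℓ, p i) ∧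
      ∀ j ∈ Icc 1 ℓ, ∃ a : ℕ, j * x = a ^ p j := by
  set I := Icc 1 ℓ
  set M := ∏ i ∈ I, p i
  have hex : ∀ i : ℕ, ∃ e : ℕ, i ∈ I → e ≤ M ∧ p i ∣ e + 1 ∧ ∀ j ∈ I, j ≠ i → p j ∣ e := by
    intro i
    have hco : Nat.Coprime (∏ j ∈ I.erase i, p j) (p i) :=
      Nat.Coprime.prod_left fun j hj => hp (ne_of_mem_erase hj)
    have hQ : 0 < ∏ j ∈ I.erase i, p j := prod_pos fun j _ => hpos j
    refine ⟨Nat.chineseRemainder hco 0 (p i - 1), fun hi => ⟨?_, ?_, ?_⟩⟩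
    · rw [show M = (∏ j ∈ I.erase i, p j) * p i from (prod_erase_mul I p hi).symm]
      exact (Nat.chineseRemainder_lt_mul hco _ _ hQ.ne' (hpos i).ne').le
    · have := ((Nat.chineseRemainder hco 0 (p i - 1)).2.2).add_right 1
      rw [Nat.sub_add_cancel (hpos i)] at this
      exact (this.dvd_iff dvd_rfl).2 dvd_rfl
    · intro j hj hji
      have := (Nat.chineseRemainder hco 0 (p i - 1)).2.1
      exact (dvd_prod_of_mem p (mem_erase.2 ⟨hji, hj⟩)).trans (Nat.modEq_zero_iff_dvd.1 this)
  choose e he using hex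
  refine ⟨∏ i ∈ I, i ^ e i, prod_pos fun i hi => pow_pos (mem_Icc.1 hi).1 _, ?_, fun j hj => ?_⟩
  · calc ∏ i ∈ I, i ^ e i ≤ ∏ _i ∈ I, ℓ ^ M := by
          refine prod_le_prod' fun i hi => ?_
          obtain ⟨h1, h2⟩ := mem_Icc.1 hi
          exact (Nat.pow_le_pow_left h2 _).trans (Nat.pow_le_pow_right (by omega) (he i hi).1)
      _ = ℓ ^ (ℓ * M) := by
          rw [prod_const, ← pow_mul, mul_comm]
          simp [I]
  · refine ⟨∏ i ∈ I, i ^ ((e i + if i = j then 1 else 0) / p j), ?_⟩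
    have h1 : ∏ i ∈ I, i ^ (if i = j then 1 else 0) = j := by
      rw [prod_eq_single j (fun b _ hb => by simp [hb]) (fun h => absurd hj h)]
      simp
    rw [← prod_pow]
    conv_lhs => rw [← h1]
    rw [← prod_mul_distrib]
    refine prod_congr rfl fun i hi => ?_
    rw [← pow_add, ← pow_mul, Nat.div_mul_cancel, add_comm]
    by_cases hij : i = j
    · subst hij
      simpa using (he i hi).2.1
    · simpa [hij] using (he i hi).2.2 j hj (Ne.symm hij)

lemma exists_progression {ℓ : ℕ} (h2 : 2 ≤ ℓ) (hℓ : ℓ < Nat.primeCounting (ℓ ^ 2)) :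
    ∃ x : ℕ, 0 < x ∧ ∀ j : ℕ, 1 ≤ j → j ≤ ℓ →
      IsPurePower (j * x) ∧ j * x ≤ ℓ ^ (ℓ ^ (2 * ℓ + 2)) := by
  have hprime := Nat.prime_nth_prime
  have hmono : StrictMono (Nat.nth Nat.Prime) := Nat.nth_strictMono Nat.infinite_setOfPred_prime
  obtain ⟨x, hx, hxle, hpow⟩ := exists_forall_mul_eq_pow ℓ (Nat.nth Nat.Prime)
    (fun i => (hprime i).pos)
    (fun i j hij => (Nat.coprime_primes (hprime i) (hprime j)).2 (hmono.injective.ne hij))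
  set M := ∏ i ∈ Icc 1 ℓ, Nat.nth Nat.Prime i
  have hM : M ≤ ℓ ^ (2 * ℓ) := by
    calc M ≤ ∏ _i ∈ Icc 1 ℓ, ℓ ^ 2 := by
          refine prod_le_prod' fun i hi => ?_
          have : Nat.nth Nat.Prime ℓ < ℓ ^ 2 + 1 := Nat.nth_lt_of_lt_count hℓ
          have := hmono.monotone (mem_Icc.1 hi).2
          omega
      _ = ℓ ^ (2 * ℓ) := by simp [pow_mul]
  refine ⟨x, hx, fun j h1 hj => ⟨?_, ?_⟩⟩
  · obtain ⟨a, ha⟩ := hpow j (mem_Icc.2 ⟨h1, hj⟩)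
    refine ⟨a, _, Nat.pos_of_ne_zero ?_, (hprime j).two_le, ha⟩
    rintro rfl
    rw [zero_pow (hprime j).ne_zero] at ha
    have := Nat.mul_pos h1 hx
    omega
  · calc j * x ≤ ℓ * ℓ ^ (ℓ * M) := Nat.mul_le_mul hj hxle
      _ = ℓ ^ (ℓ * M + 1) := by rw [pow_succ, mul_comm]
      _ ≤ ℓ ^ (ℓ ^ (2 * ℓ + 2)) := by
          refine Nat.pow_le_pow_right (by omega) ?_
          have h3 : 1 ≤ ℓ ^ (2 * ℓ) := Nat.one_le_pow _ _ (by omega)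
          have h4 : ℓ * M ≤ ℓ * ℓ ^ (2 * ℓ) := Nat.mul_le_mul_left _ hM
          calc ℓ * M + 1 ≤ ℓ * ℓ ^ (2 * ℓ) + ℓ * ℓ ^ (2 * ℓ) := by nlinarith
            _ = 2 * (ℓ * ℓ ^ (2 * ℓ)) := by ring
            _ ≤ ℓ * (ℓ * ℓ ^ (2 * ℓ)) := Nat.mul_le_mul_right _ h2
            _ = ℓ ^ (2 * ℓ + 2) := by ring

lemma exists_length_ge :
    ∀ᶠ N : ℕ in atTop, ∃ ℓ x : ℕ, 0 < ℓ ∧ 0 < x ∧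
      (∀ j : ℕ, 1 ≤ j → j ≤ ℓ → IsPurePower (j * x) ∧ j * x ≤ N) ∧
      1 / 20 * Real.log (Real.log N) / Real.log (Real.log (Real.log N)) ≤ (ℓ : ℝ) := by
  have hy : Tendsto (fun N : ℕ => Real.log (Real.log N)) atTop atTop :=
    Real.tendsto_log_atTop.comp (Real.tendsto_log_atTop.comp tendsto_natCast_atTop_atTop)
  have hdiv : Tendsto (fun y : ℝ => y / (10 * Real.log y)) atTop atTop := by
    refine tendsto_atTop_mono' atTop ?_
      (Real.tendsto_sqrt_atTop.const_mul_atTop (by norm_num : (0 : ℝ) < 1 / 20))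
    filter_upwards [eventually_gt_atTop 1] with y h1
    have hl : 0 < Real.log y := Real.log_pos h1
    rw [le_div_iff₀ (by positivity)]
    nlinarith [log_le_two_mul_sqrt (by linarith : 0 < y), Real.mul_self_sqrt (by linarith : 0 ≤ y),
      Real.sqrt_nonneg y]
  have hfloor := tendsto_nat_floor_atTop.comp (hdiv.comp hy)
  filter_upwards [hy.eventually_ge_atTop 3,
    hfloor.eventually (eventually_lt_primeCounting_sq.and (eventually_ge_atTop 2))]
    with N hN3 hev
  simp only [Function.comp_apply] at hev
  set L := Real.log N with hL
  set y := Real.log L with hy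
  set ℓ := ⌊y / (10 * Real.log y)⌋₊ with hℓdef
  obtain ⟨hℓ, h2⟩ := hev
  obtain ⟨x, hx, hpow⟩ := exists_progression h2 hℓ
  have h2' : (2 : ℝ) ≤ ℓ := by exact_mod_cast h2
  have hlogy1 : 1 ≤ Real.log y := by
    rw [Real.le_log_iff_exp_le (by linarith)]
    linarith [Real.exp_one_lt_d9]
  have hℓy : (ℓ : ℝ) ≤ y / (10 * Real.log y) := Nat.floor_le (by positivity)
  have hℓmul : ℓ * (10 * Real.log y) ≤ y := by rwa [le_div_iff₀ (by positivity)] at hℓy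
  have hlogℓ : Real.log ℓ ≤ Real.log y := Real.log_le_log (by linarith) (by nlinarith)
  have hL0 : 0 < L := by
    have : 0 ≤ L := Real.log_natCast_nonneg N
    rcases this.eq_or_lt with h0 | h0
    · rw [hy, ← h0, Real.log_zero] at hN3
      norm_num at hN3
    · exact h0
  have hN0 : (0 : ℝ) < N := by
    rcases (Nat.cast_nonneg N : (0 : ℝ) ≤ N).eq_or_lt with h0 | h0
    · rw [hL, ← h0, Real.log_zero] at hL0
      exact absurd hL0 (lt_irrefl _)
    · exact h0
  have hbound : ℓ ^ (ℓ ^ (2 * ℓ + 2)) ≤ N := by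
    have h1 : (ℓ : ℝ) ^ (2 * ℓ + 3) ≤ L := by
      rw [← Real.log_le_log_iff (by positivity) hL0, Real.log_pow]
      push_cast
      have := Real.log_nonneg (by linarith : (1 : ℝ) ≤ ℓ)
      nlinarith
    have h2 : ((ℓ : ℝ) ^ (ℓ ^ (2 * ℓ + 2))) ≤ N := by
      rw [← Real.log_le_log_iff (by positivity) hN0, Real.log_pow]
      refine le_trans ?_ h1
      push_cast
      rw [pow_succ (ℓ : ℝ) (2 * ℓ + 2)]
      gcongr
      exact Real.log_le_self (by linarith)
    exact_mod_cast h2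
  refine ⟨ℓ, x, by omega, hx, fun j h1 hj =>
    ⟨(hpow j h1 hj).1, (hpow j h1 hj).2.trans hbound⟩, ?_⟩
  have hlt : y / (10 * Real.log y) < ℓ + 1 := Nat.lt_floor_add_one _
  have : 1 / 20 * y / Real.log y = (y / (10 * Real.log y)) / 2 := by
    field_simp
    norm_num
  rw [this]
  linarith

/-- The maximal `ℓ` such that `x, 2x, …, ℓx` are all pure powers at most `N`
satisfies `ℓ(N) ≍ log log N / log log log N`. -/
theorem stmt_17 :
    ∃ c₁ c₂ : ℝ, 0 < c₁ ∧ 0 < c₂ ∧ ∃ N₀ : ℕ, ∀ N : ℕ, N₀ ≤ N →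
      (∃ ℓ x : ℕ, 0 < ℓ ∧ 0 < x ∧
        (∀ j : ℕ, 1 ≤ j → j ≤ ℓ → IsPurePower (j * x) ∧ j * x ≤ N) ∧
        c₁ * Real.log (Real.log N) / Real.log (Real.log (Real.log N)) ≤ (ℓ : ℝ)) ∧
      (∀ ℓ x : ℕ, 0 < x →
        (∀ j : ℕ, 1 ≤ j → j ≤ ℓ → IsPurePower (j * x) ∧ j * x ≤ N) →
        (ℓ : ℝ) ≤ c₂ * Real.log (Real.log N) / Real.log (Real.log (Real.log N))) := by
  have hy : Tendsto (fun N : ℕ => Real.log (Real.log N)) atTop atTop :=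
    Real.tendsto_log_atTop.comp (Real.tendsto_log_atTop.comp tendsto_natCast_atTop_atTop)
  obtain ⟨N₀, hN₀⟩ := eventually_atTop.1 (exists_length_ge.and (hy.eventually_ge_atTop 3))
  exact ⟨1 / 20, 64, by norm_num, by norm_num, N₀, fun N hN =>
    ⟨(hN₀ N hN).1, fun _ _ hx h => length_le (hN₀ N hN).2 hx h⟩⟩
end
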